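/- arXiv:2006.04020 — 2 statements merged into one kernel-verified Lean document; each statement's English description precedes it below -/
import Mathlib

section
/- Fix 0 < α ≤ 2 and t > 0. For every measurable g : (0,t) → ℂ with ∫_0^t |g(τ)|² τ^α dτ < ∞, the function F := L_t^α g is holomorphic on Δ_α and satisfies the isometry identity ∫_{Δ_α} |F(z)|² dμ_α^t(z) = t^{-α} ∫_0^t |g(τ)|² τ^α dτ. -/
open MeasureTheory Filter Set Complex

/-- The open sector `Δ_α = {z ≠ 0 : |arg z| < πα/4}`. -/
def sector (α : ℝ) : Set ℂ :=
  {z : ℂ | z ≠ 0 ∧ |Complex.arg z| < Real.pi * α / 4}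

/-- The complex kernel `K_α(z,s) = (α^α/(2^α Γ(α/2))) z s^{-(α/2+1)} exp(-α² z^{2/α}/(4s))`,
where `z^{2/α}` is taken with the principal branch. -/
noncomputable def Kc (α : ℝ) (z : ℂ) (s : ℝ) : ℂ :=
  ((α ^ α / (2 ^ α * Real.Gamma (α / 2)) : ℝ) : ℂ) * z * (((s ^ (-(α / 2 + 1)) : ℝ)) : ℂ) *
    Complex.exp (-(α ^ 2 : ℂ) * z ^ (((2 / α : ℝ)) : ℂ) / (4 * (s : ℂ)))

/-- The transform `(L_t^α g)(z) = t^{-α} ∫_0^t K_α(z,t-τ) g(τ) τ^α dτ`. -/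
noncomputable def Lc (α t : ℝ) (g : ℝ → ℂ) (z : ℂ) : ℂ :=
  ((t ^ (-α) : ℝ) : ℂ) *
    ∫ τ in Set.Ioo (0 : ℝ) t, Kc α z (t - τ) * g τ * ((τ ^ α : ℝ) : ℂ)

/-- The Beta function `B(a,b) = Γ(a)Γ(b)/Γ(a+b)`. -/
noncomputable def betaFn (a b : ℝ) : ℝ := Real.Gamma a * Real.Gamma b / Real.Gamma (a + b)

/-- The density of the measure `μ_α^t` with respect to the area measure on `Δ_α`. -/
noncomputable def muDens (α t : ℝ) (z : ℂ) : ℝ :=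
  (Real.pi)⁻¹ * 2 ^ (α - 1) * betaFn (α / 2) (α / 2) * ‖z‖ ^ (4 * (1 - α) / α) *
    Real.exp (α ^ 2 / (2 * t) * (z ^ (((2 / α : ℝ)) : ℂ)).re) *
      ((z ^ (((2 / α : ℝ)) : ℂ)).re) ^ (α - 1)


open FourierTransform SchwartzMap in
theorem aux_fourier_ae (f : ℝ → ℂ) (h1 : Integrable f) (h2 : MemLp f 2) :
    𝓕 f =ᵐ[volume] ((𝓕 (h2.toLp f) : Lp (α := ℝ) ℂ 2 volume) : ℝ → ℂ) := by
  have hc : Continuous (𝓕 f) := by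
    exact VectorFourier.fourierIntegral_continuous Real.continuous_fourierChar (by fun_prop) h1
  refine ae_eq_of_integral_contDiff_smul_eq hc.locallyIntegrable ?_ ?_
  · exact (Lp.memLp _).locallyIntegrable (by norm_num)
  intro φ hφ hφc
  have hφ' : HasCompactSupport (fun x => (φ x : ℂ)) := hφc.comp_left (g := fun x : ℝ => (x:ℂ)) (by simp)
  have hφd : ContDiff ℝ ((⊤ : ℕ∞) : WithTop ℕ∞) (fun x => (φ x : ℂ)) := Complex.ofRealCLM.contDiff.comp hφ
  let Φ : 𝓢(ℝ, ℂ) := hφ'.toSchwartzMap hφd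
  have hΦ : ∀ x, Φ x = φ x := fun x => by simp [Φ]
  have key := congrArg (fun T => T Φ) (MeasureTheory.Lp.fourier_toTemperedDistribution_eq (h2.toLp f))
  simp only [TemperedDistribution.fourier_apply, Lp.toTemperedDistribution_apply (μ := volume)] at key
  have e1 : ∫ x, φ x • (𝓕 (h2.toLp f) : Lp (α := ℝ) ℂ 2 volume) x = ∫ x, Φ x • (𝓕 (h2.toLp f) : Lp (α := ℝ) ℂ 2 volume) x := by
    simp [hΦ]
  rw [e1, ← key]
  have e2 : ∫ x, (𝓕 Φ) x • (h2.toLp f) x = ∫ x, (𝓕 Φ) x • f x := by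
    refine integral_congr_ae ?_
    filter_upwards [h2.coeFn_toLp] with x hx
    rw [hx]
  rw [e2]
  have e3 : ∫ x, φ x • 𝓕 f x = ∫ x, Φ x • 𝓕 f x := by simp [hΦ]
  rw [e3]
  have := VectorFourier.integral_fourierIntegral_smul_eq_flip (L := innerₗ ℝ) (μ := volume) (ν := volume)
    Real.continuous_fourierChar (by fun_prop) (Φ.integrable) h1
  rw [SchwartzMap.fourier_coe]
  symm
  simpa using! this

open FourierTransform in
theorem aux_plancherel (f : ℝ → ℂ) (h1 : Integrable f) (h2 : MemLp f 2) :
    ∫⁻ ξ, ‖𝓕 f ξ‖ₑ ^ 2 = ∫⁻ x, ‖f x‖ₑ ^ 2 := by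
  have h := MeasureTheory.Lp.norm_fourier_eq (h2.toLp f)
  have e : eLpNorm (𝓕 f) 2 volume = eLpNorm f 2 volume := by
    rw [eLpNorm_congr_ae (aux_fourier_ae f h1 h2), ← eLpNorm_congr_ae h2.coeFn_toLp]
    rw [Lp.norm_def, Lp.norm_def] at h
    exact (ENNReal.toReal_eq_toReal_iff' (Lp.eLpNorm_ne_top _) (Lp.eLpNorm_ne_top _)).1 h
  have := congrArg (fun a => a ^ (2:ℕ)) e
  simp only [eLpNorm_eq_lintegral_rpow_enorm_toReal (p := 2) (by norm_num) (by norm_num)] at this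
  simp only [← ENNReal.rpow_natCast, ← ENNReal.rpow_mul] at this
  norm_num at this
  exact this

theorem aux_line (h : ℝ → ℂ) (x : ℝ)
    (h1 : IntegrableOn (fun v => h v * Complex.exp (-(v * x : ℝ))) (Ioi 0))
    (h2 : MemLp (fun v => h v * Complex.exp (-(v * x : ℝ))) 2 (volume.restrict (Ioi 0))) :
    ∫⁻ y : ℝ, ‖∫ v in Ioi (0:ℝ), h v * Complex.exp (-(v * (x + y * I)))‖ₑ ^ 2 =
      ENNReal.ofReal (2 * Real.pi) * ∫⁻ v in Ioi (0:ℝ), ‖h v‖ₑ ^ 2 * ENNReal.ofReal (Real.exp (-2 * v * x)) := by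
  set f : ℝ → ℂ := (Ioi (0:ℝ)).indicator (fun v => h v * Complex.exp (-(v * x : ℝ))) with hf
  have H1 : Integrable f := (integrable_indicator_iff measurableSet_Ioi).2 h1
  have H2 : MemLp f 2 := (memLp_indicator_iff_restrict measurableSet_Ioi).2 h2
  have P := aux_plancherel f H1 H2
  have hF : ∀ ξ : ℝ, FourierTransform.fourier f ξ = ∫ v in Ioi (0:ℝ), h v * Complex.exp (-(v * (x + (2 * Real.pi * ξ : ℝ) * I))) := by
    intro ξ
    rw [Real.fourier_real_eq_integral_exp_smul, ← integral_indicator measurableSet_Ioi]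
    congr 1
    ext v
    by_cases hv : v ∈ Ioi (0:ℝ)
    · simp only [hf, indicator_of_mem hv, smul_eq_mul]
      rw [mul_left_comm, ← Complex.exp_add]
      congr 2
      push_cast; ring
    · simp [hf, indicator_of_notMem hv]
  have hs : (fun ξ : ℝ => 2 * Real.pi * ξ) '' univ = univ := by
    rw [image_univ]
    apply Function.Surjective.range_eq
    intro y
    exact ⟨y / (2 * Real.pi), by field_simp⟩
  have S := lintegral_image_eq_lintegral_abs_deriv_mul (s := univ) (f := fun ξ : ℝ => 2 * Real.pi * ξ)
    (f' := fun _ => 2 * Real.pi) MeasurableSet.univ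
    (fun ξ _ => by simpa using ((hasDerivAt_id ξ).const_mul (2 * Real.pi)))
    (fun a _ b _ hab => by
      have : 2 * Real.pi ≠ 0 := by positivity
      exact mul_left_cancel₀ this hab)
    (fun y : ℝ => ‖∫ v in Ioi (0:ℝ), h v * Complex.exp (-(v * (x + y * I)))‖ₑ ^ 2)
  rw [hs] at S
  simp only [Measure.restrict_univ] at S
  rw [S, lintegral_const_mul' _ _ ENNReal.ofReal_ne_top, abs_of_pos (by positivity)]
  congr 1
  simp only [← hF]
  rw [P, ← lintegral_indicator measurableSet_Ioi]
  congr 1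
  ext v
  by_cases hv : v ∈ Ioi (0:ℝ)
  · simp only [hf, indicator_of_mem hv, enorm_mul, mul_pow]
    congr 1
    rw [← ofReal_norm, ← ENNReal.ofReal_pow (norm_nonneg _), Complex.norm_exp, ← Real.exp_nat_mul]
    congr 2
    simp
    ring
  · simp [hf, indicator_of_notMem hv]

/-- integrand of the Laplace transform -/
noncomputable def auxLap (h : ℝ → ℂ) (w : ℂ) : ℂ := ∫ v in Ioi (0:ℝ), h v * Complex.exp (-(v * w))

theorem aux_int_gamma (α x : ℝ) (hα : -1 < α) (hx : 0 < x) :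
    IntegrableOn (fun v : ℝ => v ^ α * Real.exp (-x * v)) (Ioi 0) := by
  simpa using integrableOn_rpow_mul_exp_neg_mul_rpow (p := 1) (s := α) (b := x) hα one_pos hx

theorem aux_L1 (h : ℝ → ℂ) (hm : Measurable h) (α x : ℝ) (hα : 0 < α) (hx : 0 < x)
    (hN : IntegrableOn (fun v => ‖h v‖ ^ 2 * v ^ (-α)) (Ioi 0)) :
    IntegrableOn (fun v => h v * Complex.exp (-(v * x : ℝ))) (Ioi 0) := by
  have hb := hN.add (aux_int_gamma α (2 * x) (by linarith) (by positivity))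
  refine hb.mono' (by fun_prop) ?_
  refine (ae_restrict_mem measurableSet_Ioi).mono fun v hv => ?_
  have hv : 0 < v := hv
  simp only [Pi.add_apply, norm_mul, Complex.norm_exp]
  have e1 : v ^ (-α) = (v ^ (-(α/2))) ^ 2 := by
    rw [← Real.rpow_natCast, ← Real.rpow_mul hv.le]; congr 1; push_cast; ring
  have e2 : v ^ α = (v ^ (α/2)) ^ 2 := by
    rw [← Real.rpow_natCast, ← Real.rpow_mul hv.le]; congr 1; push_cast; ring
  have e3 : Real.exp (-(2 * x) * v) = (Real.exp (-(v * x))) ^ 2 := by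
    rw [← Real.exp_nat_mul]; congr 1; push_cast; ring
  have e4 : v ^ (-(α/2)) * v ^ (α/2) = 1 := by
    rw [← Real.rpow_add hv]; simp
  have e5 : (-(((v * x : ℝ)) : ℂ)).re = -(v * x) := by simp
  rw [e1, e2, e3, e5, ← mul_pow, ← mul_pow]
  have := two_mul_le_add_sq (‖h v‖ * v ^ (-(α/2))) (v ^ (α/2) * Real.exp (-(v*x)))
  have e6 : 2 * (‖h v‖ * v ^ (-(α/2))) * (v ^ (α/2) * Real.exp (-(v*x))) = 2 * (‖h v‖ * Real.exp (-(v*x))) := by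
    linear_combination 2 * ‖h v‖ * Real.exp (-(v*x)) * e4
  have : 0 ≤ ‖h v‖ * Real.exp (-(v*x)) := by positivity
  linarith

theorem aux_rpow_exp (α x v : ℝ) (hα : 0 < α) (hx : 0 < x) (hv : 0 < v) :
    v ^ α * Real.exp (-(2 * v * x)) ≤ (2 * x / α) ^ (-α) := by
  have hε : 0 < 2 * x / α := by positivity
  have h1 : v ≤ Real.exp (v * (2 * x / α)) / (2 * x / α) := by
    rw [le_div_iff₀ hε]
    have := Real.add_one_le_exp (v * (2 * x / α))
    linarith
  have h2 : v ^ α ≤ (Real.exp (v * (2 * x / α)) / (2 * x / α)) ^ α := Real.rpow_le_rpow hv.le h1 hα.le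
  rw [Real.div_rpow (Real.exp_pos _).le hε.le, ← Real.exp_mul] at h2
  have e : v * (2 * x / α) * α = 2 * v * x := by field_simp
  rw [e] at h2
  calc v ^ α * Real.exp (-(2 * v * x)) ≤ (Real.exp (2 * v * x) / (2 * x / α) ^ α) * Real.exp (-(2 * v * x)) := by gcongr
    _ = _ := by
      rw [Real.rpow_neg hε.le, Real.exp_neg]
      field_simp

theorem aux_L2 (h : ℝ → ℂ) (hm : Measurable h) (α x : ℝ) (hα : 0 < α) (hx : 0 < x)
    (hN : IntegrableOn (fun v => ‖h v‖ ^ 2 * v ^ (-α)) (Ioi 0)) :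
    MemLp (fun v => h v * Complex.exp (-(v * x : ℝ))) 2 (volume.restrict (Ioi 0)) := by
  rw [memLp_two_iff_integrable_sq_norm (by fun_prop)]
  refine (hN.const_mul ((2 * x / α) ^ (-α))).mono' (by fun_prop) ?_
  refine (ae_restrict_mem measurableSet_Ioi).mono fun v hv => ?_
  have hv : 0 < v := hv
  have := aux_rpow_exp α x v hα hx hv
  have e5 : (-(((v * x : ℝ)) : ℂ)).re = -(v * x) := by simp
  rw [norm_pow, norm_norm, norm_mul, Complex.norm_exp, e5, mul_pow, ← Real.exp_nat_mul]
  have e4 : v ^ (-α) * v ^ α = 1 := by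
    rw [← Real.rpow_add hv]; simp
  have e3 : ((2:ℕ):ℝ) * -(v * x) = -(2 * v * x) := by push_cast; ring
  rw [e3]
  calc _ = ‖h v‖ ^ 2 * v ^ (-α) * (v ^ α * Real.exp (-(2 * v * x))) := by
        linear_combination (-‖h v‖ ^ 2 * Real.exp (-(2 * v * x))) * e4
    _ ≤ ‖h v‖ ^ 2 * v ^ (-α) * (2 * x / α) ^ (-α) := by gcongr
    _ = _ := by ring

theorem aux_diff (h : ℝ → ℂ) (hm : Measurable h) (α : ℝ) (hα : 0 < α)
    (hN : IntegrableOn (fun v => ‖h v‖ ^ 2 * v ^ (-α)) (Ioi 0)) (w : ℂ) (hw : 0 < w.re) :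
    DifferentiableAt ℂ (auxLap h) w := by
  set x := w.re / 4 with hx
  have hx0 : 0 < x := by positivity
  have I1 := (aux_L1 h hm α x hα hx0 hN).norm.const_mul (1 / x)
  have hs : {z : ℂ | w.re / 2 < z.re} ∈ nhds w :=
    (isOpen_lt continuous_const Complex.continuous_re).mem_nhds (by simp; linarith)
  refine (hasDerivAt_integral_of_dominated_loc_of_deriv_le (μ := volume.restrict (Ioi 0))
    (F := fun w v => h v * Complex.exp (-(v * w)))
    (F' := fun w v => h v * (Complex.exp (-(v * w)) * (-v))) hs
    (.of_forall fun z => by fun_prop) ?_ (by fun_prop) ?_ I1 ?_).2.differentiableAt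
  · have := (aux_L1 h hm α w.re hα hw hN)
    refine this.norm.mono' (by fun_prop) (.of_forall fun v => ?_)
    simp [Complex.norm_exp]
  · refine (ae_restrict_mem measurableSet_Ioi).mono fun v hv z hz => ?_
    have hv : 0 < v := hv
    have hz : w.re / 2 < z.re := hz
    simp only [norm_mul, Complex.norm_exp, norm_neg, Complex.norm_real, Real.norm_eq_abs, abs_of_pos hv]
    have e5 : (-(((v * x : ℝ)) : ℂ)).re = -(v * x) := by simp
    have e6 : (-((v : ℂ) * z)).re = -(v * z.re) := by simp
    rw [e5, e6]
    have k1 : v * x ≤ Real.exp (v * x) := by have := Real.add_one_le_exp (v * x); linarith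
    have k2 : Real.exp (-(v * z.re)) ≤ Real.exp (-(v * x)) * Real.exp (-(v * x)) := by
      rw [← Real.exp_add]; apply Real.exp_le_exp.2; nlinarith
    have k3 : Real.exp (v * x) * Real.exp (-(v * x)) = 1 := by rw [← Real.exp_add]; simp
    have k4 : Real.exp (-(v * z.re)) * v ≤ 1 / x * Real.exp (-(v * x)) := by
      rw [div_mul_eq_mul_div, le_div_iff₀ hx0]
      calc Real.exp (-(v * z.re)) * v * x = Real.exp (-(v * z.re)) * (v * x) := by ring
        _ ≤ (Real.exp (-(v * x)) * Real.exp (-(v * x))) * Real.exp (v * x) := by gcongr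
        _ = _ := by linear_combination Real.exp (-(v * x)) * k3
    calc _ ≤ ‖h v‖ * (1 / x * Real.exp (-(v * x))) := by gcongr
      _ = _ := by ring
  · refine .of_forall fun v z _ => ?_
    refine HasDerivAt.const_mul _ ?_
    refine HasDerivAt.cexp ?_
    have := ((hasDerivAt_id z).const_mul (v : ℂ)).neg
    rw [mul_one] at this
    exact this

theorem aux_gamma (α v : ℝ) (hα : 0 < α) (hv : 0 < v) :
    ∫⁻ x in Ioi (0:ℝ), ENNReal.ofReal (Real.exp (-2 * v * x)) * ENNReal.ofReal (x ^ (α - 1)) =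
      ENNReal.ofReal (Real.Gamma α * 2 ^ (-α)) * ENNReal.ofReal (v ^ (-α)) := by
  have h1 := _root_.integral_rpow_mul_exp_neg_mul_rpow (p := 1) (q := α - 1) (b := 2 * v) one_pos (by linarith) (by positivity)
  have h2 := aux_int_gamma (α - 1) (2 * v) (by linarith) (by positivity)
  simp only [Real.rpow_one, sub_add_cancel, div_one, mul_one] at h1
  rw [← ENNReal.ofReal_mul (by have := Real.Gamma_pos_of_pos hα; positivity)]
  have : Real.Gamma α * 2 ^ (-α) * v ^ (-α) = (2 * v) ^ (-α) * Real.Gamma α := by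
    rw [Real.mul_rpow (by norm_num) hv.le]; ring
  rw [this, ← h1, ofReal_integral_eq_lintegral_ofReal h2]
  · refine setLIntegral_congr_fun measurableSet_Ioi fun x hx => ?_
    rw [← ENNReal.ofReal_mul (by positivity)]
    congr 1
    rw [mul_comm]; congr 2; ring
  · refine (ae_restrict_mem measurableSet_Ioi).mono fun x hx => ?_
    have hx : 0 < x := hx
    simp only [Pi.zero_apply]
    positivity

theorem aux_main (h : ℝ → ℂ) (hm : Measurable h) (α : ℝ) (hα : 0 < α)
    (hN : IntegrableOn (fun v => ‖h v‖ ^ 2 * v ^ (-α)) (Ioi 0)) :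
    ∫⁻ w in {w : ℂ | 0 < w.re}, ‖auxLap h w‖ₑ ^ 2 * ENNReal.ofReal (w.re ^ (α - 1)) =
      ENNReal.ofReal (2 * Real.pi) * (ENNReal.ofReal (Real.Gamma α * 2 ^ (-α)) *
        ∫⁻ v in Ioi (0:ℝ), ‖h v‖ₑ ^ 2 * ENNReal.ofReal (v ^ (-α))) := by
  have hopen : IsOpen {w : ℂ | 0 < w.re} := isOpen_lt continuous_const Complex.continuous_re
  have hU : MeasurableSet {w : ℂ | 0 < w.re} := hopen.measurableSet
  have hcont : ContinuousOn (auxLap h) {w : ℂ | 0 < w.re} := fun w hw =>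
    (aux_diff h hm α hα hN w hw).continuousAt.continuousWithinAt
  have hmeas : Measurable ({w : ℂ | 0 < w.re}.indicator (auxLap h)) := by
    classical
    rw [← Set.piecewise_eq_indicator]
    exact hcont.measurable_piecewise continuousOn_const hU
  set G : ℂ → ENNReal := fun w => ‖({w : ℂ | 0 < w.re}.indicator (auxLap h)) w‖ₑ ^ 2 *
    ENNReal.ofReal (w.re ^ (α - 1)) with hG
  have hGm : Measurable G := by
    rw [hG]
    refine (hmeas.enorm.pow_const 2).mul ?_
    fun_prop
  have e1 : ∫⁻ w in {w : ℂ | 0 < w.re}, ‖auxLap h w‖ₑ ^ 2 * ENNReal.ofReal (w.re ^ (α - 1)) = ∫⁻ w, G w := by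
    rw [← lintegral_indicator hU]
    congr 1; ext w
    by_cases hw : w ∈ {w : ℂ | 0 < w.re}
    · simp only [hG, indicator_of_mem hw]
    · simp [hG, indicator_of_notMem hw]
  rw [e1, ← (Complex.volume_preserving_equiv_real_prod.symm).lintegral_comp_emb
    Complex.measurableEquivRealProd.symm.measurableEmbedding, Measure.volume_eq_prod, lintegral_prod (fun p => G (Complex.measurableEquivRealProd.symm p))
      (hGm.comp Complex.measurableEquivRealProd.symm.measurable).aemeasurable]
  have e2 : ∀ x : ℝ, ∫⁻ y : ℝ, G (Complex.measurableEquivRealProd.symm (x, y)) =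
      (Ioi (0:ℝ)).indicator (fun x => ENNReal.ofReal (2 * Real.pi) *
        ∫⁻ v in Ioi (0:ℝ), ‖h v‖ₑ ^ 2 * (ENNReal.ofReal (Real.exp (-2 * v * x)) * ENNReal.ofReal (x ^ (α - 1)))) x := by
    intro x
    by_cases hx : x ∈ Ioi (0:ℝ)
    · have hx' : 0 < x := hx
      rw [indicator_of_mem hx]
      have := aux_line h x (aux_L1 h hm α x hα hx' hN) (aux_L2 h hm α x hα hx' hN)
      simp only [← mul_assoc]
      rw [lintegral_mul_const' _ _ ENNReal.ofReal_ne_top, ← mul_assoc, ← this,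
        ← lintegral_mul_const' _ _ ENNReal.ofReal_ne_top]
      congr 1; ext y
      have hxy : (Complex.measurableEquivRealProd.symm (x, y)) = x + y * I := by
        apply Complex.ext <;> simp [Complex.measurableEquivRealProd_symm_apply]
      have hmem : (x + y * I : ℂ) ∈ {w : ℂ | 0 < w.re} := by simpa using hx'
      rw [hxy]
      simp only [hG, indicator_of_mem hmem, auxLap]
      simp
    · rw [indicator_of_notMem hx]
      have : ∀ y : ℝ, G (Complex.measurableEquivRealProd.symm (x, y)) = 0 := by
        intro y
        have hmem : (Complex.measurableEquivRealProd.symm (x, y)) ∉ {w : ℂ | 0 < w.re} := by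
          simpa [Complex.measurableEquivRealProd_symm_apply] using hx
        simp only [hG, indicator_of_notMem hmem]
        simp
      simp only [this, lintegral_zero]
  simp only [e2]
  rw [lintegral_indicator measurableSet_Ioi, lintegral_const_mul' _ _ ENNReal.ofReal_ne_top]
  congr 1
  rw [lintegral_lintegral_swap (by
    unfold Function.uncurry
    fun_prop), ← lintegral_const_mul' _ _ ENNReal.ofReal_ne_top]
  refine setLIntegral_congr_fun measurableSet_Ioi fun v hv => ?_
  rw [lintegral_const_mul' _ _ (by simp), aux_gamma α v hα hv]
  ring

/-- inverse substitution -/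
noncomputable def auxT (α t v : ℝ) : ℝ := t - (α ^ 2 / 4) / (v + (α ^ 2 / 4) / t)

/-- forward substitution -/
noncomputable def auxPhi (α t τ : ℝ) : ℝ := (α ^ 2 / 4) / (t - τ) - (α ^ 2 / 4) / t

/-- transformed function -/
noncomputable def auxH (α t : ℝ) (g : ℝ → ℂ) (v : ℝ) : ℂ :=
  g (auxT α t v) * (((auxT α t v) ^ α * (t - auxT α t v) ^ (-(α / 2 + 1)) *
    ((t - auxT α t v) ^ 2 / (α ^ 2 / 4)) : ℝ) : ℂ)

theorem auxH_meas (α t : ℝ) (g : ℝ → ℂ) (hg : Measurable g) : Measurable (auxH α t g) := by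
  have hT : Measurable (auxT α t) := by unfold auxT; fun_prop
  unfold auxH
  fun_prop

theorem auxT_phi (α t τ : ℝ) (hα : 0 < α) (h : τ < t) :
    auxT α t (auxPhi α t τ) = τ := by
  have : t - τ ≠ 0 := by linarith
  unfold auxT auxPhi
  rw [sub_add_cancel, div_div_cancel₀ (by positivity)]
  ring

theorem auxPhi_eq (α t τ : ℝ) (ht : 0 < t) (h : τ < t) :
    auxPhi α t τ = (α ^ 2 / 4) * τ / (t * (t - τ)) := by
  have : t - τ ≠ 0 := by linarith
  unfold auxPhi
  field_simp
  ring

theorem auxPhi_inj (α t : ℝ) (hα : 0 < α) : InjOn (auxPhi α t) (Ioo 0 t) := by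
  intro a ha b hb hab
  rw [← auxT_phi α t a hα ha.2, hab, auxT_phi α t b hα hb.2]

theorem auxPhi_image (α t : ℝ) (hα : 0 < α) (ht : 0 < t) : auxPhi α t '' Ioo 0 t = Ioi 0 := by
  ext v
  constructor
  · rintro ⟨τ, hτ, rfl⟩
    have h1 := hτ.1
    have h2 : 0 < t - τ := by linarith [hτ.2]
    rw [auxPhi_eq α t τ ht hτ.2]
    rw [mem_Ioi]
    positivity
  · intro hv
    have hv : 0 < v := hv
    have hc : 0 < α ^ 2 / 4 := by positivity
    have hu : 0 < v + (α ^ 2 / 4) / t := by positivity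
    refine ⟨auxT α t v, ⟨?_, ?_⟩, ?_⟩
    · unfold auxT
      rw [sub_pos, div_lt_iff₀ hu]
      have : t * (v + (α ^ 2 / 4) / t) = t * v + α ^ 2 / 4 := by field_simp
      rw [this]
      have : 0 < t * v := by positivity
      linarith
    · unfold auxT
      have : 0 < (α ^ 2 / 4) / (v + (α ^ 2 / 4) / t) := by positivity
      linarith
    · unfold auxPhi auxT
      rw [sub_sub_cancel, div_div_cancel₀ hc.ne']
      ring

theorem auxPhi_deriv (α t τ : ℝ) (h : τ < t) :
    HasDerivAt (auxPhi α t) ((α ^ 2 / 4) / (t - τ) ^ 2) τ := by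
  have h0 : t - τ ≠ 0 := by linarith
  have h1 : HasDerivAt (fun τ => t - τ) (-1) τ := by simpa using (hasDerivAt_id τ).const_sub t
  have h2 := (((h1.inv h0).const_mul (α ^ 2 / 4)).sub_const ((α ^ 2 / 4) / t))
  have e : (α ^ 2 / 4) / (t - τ) ^ 2 = (α ^ 2 / 4) * (- -1 / (t - τ) ^ 2) := by ring
  rw [e]
  exact h2

theorem auxH_pt (α t τ : ℝ) (g : ℝ → ℂ) (hα : 0 < α) (hτ : τ ∈ Ioo 0 t) :
    |(α ^ 2 / 4) / (t - τ) ^ 2| • auxH α t g (auxPhi α t τ) =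
      g τ * ((τ ^ α * (t - τ) ^ (-(α / 2 + 1)) : ℝ) : ℂ) := by
  have h2 : 0 < t - τ := by linarith [hτ.2]
  unfold auxH
  rw [auxT_phi α t τ hα hτ.2, abs_of_pos (by positivity), Complex.real_smul, mul_left_comm,
    ← Complex.ofReal_mul]
  congr 2
  field_simp

theorem auxH_sq (α t τ : ℝ) (g : ℝ → ℂ) (hα : 0 < α) (ht : 0 < t) (hτ : τ ∈ Ioo 0 t) :
    |(α ^ 2 / 4) / (t - τ) ^ 2| • (‖auxH α t g (auxPhi α t τ)‖ ^ 2 * (auxPhi α t τ) ^ (-α)) =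
      ((α ^ 2 / 4) ^ (-1 - α) * t ^ α) * (‖g τ‖ ^ 2 * τ ^ α) := by
  have h1 : 0 < τ := hτ.1
  have h2 : 0 < t - τ := by linarith [hτ.2]
  have hc : 0 < α ^ 2 / 4 := by positivity
  unfold auxH
  rw [auxT_phi α t τ hα hτ.2, abs_of_pos (by positivity), auxPhi_eq α t τ ht hτ.2]
  generalize α ^ 2 / 4 = c at *
  generalize t - τ = s at *
  rw [norm_mul, Complex.norm_real, Real.norm_eq_abs, abs_of_pos (by positivity), smul_eq_mul]
  have e1 : (c * τ / (t * s)) ^ (-α) = c ^ (-α) * (τ ^ α)⁻¹ * t ^ α * s ^ α := by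
    rw [Real.div_rpow (by positivity) (by positivity), Real.mul_rpow hc.le h1.le,
      Real.mul_rpow ht.le h2.le, Real.rpow_neg h1.le, Real.rpow_neg ht.le, Real.rpow_neg h2.le]
    field_simp
  have e2 : (s ^ (-(α / 2 + 1))) ^ 2 = (s ^ α)⁻¹ * (s ^ 2)⁻¹ := by
    rw [← Real.rpow_natCast, ← Real.rpow_mul h2.le, ← Real.rpow_neg h2.le, ← Real.rpow_natCast s 2,
      ← Real.rpow_neg h2.le, ← Real.rpow_add h2]
    congr 1; push_cast; ring
  have e3 : c ^ (-1 - α) = c⁻¹ * c ^ (-α) := by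
    rw [sub_eq_add_neg, Real.rpow_add hc, Real.rpow_neg_one]
  rw [e1, e3, mul_pow, mul_pow, mul_pow, e2]
  have : s ^ α ≠ 0 := by positivity
  have : τ ^ α ≠ 0 := by positivity
  field_simp

theorem auxH_integrable (α t : ℝ) (g : ℝ → ℂ) (hα : 0 < α) (ht : 0 < t)
    (hint : IntegrableOn (fun τ => ‖g τ‖ ^ 2 * τ ^ α) (Set.Ioo 0 t)) :
    IntegrableOn (fun v => ‖auxH α t g v‖ ^ 2 * v ^ (-α)) (Ioi 0) := by
  rw [← auxPhi_image α t hα ht, integrableOn_image_iff_integrableOn_abs_deriv_smul measurableSet_Ioo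
    (fun τ hτ => (auxPhi_deriv α t τ hτ.2).hasDerivWithinAt) (auxPhi_inj α t hα)]
  exact IntegrableOn.congr_fun (hint.const_mul ((α ^ 2 / 4) ^ (-1 - α) * t ^ α))
    (fun τ hτ => (auxH_sq α t τ g hα ht hτ).symm) measurableSet_Ioo

theorem auxH_integral (α t : ℝ) (g : ℝ → ℂ) (hα : 0 < α) (ht : 0 < t) :
    ∫ v in Ioi (0:ℝ), ‖auxH α t g v‖ ^ 2 * v ^ (-α) =
      ((α ^ 2 / 4) ^ (-1 - α) * t ^ α) * ∫ τ in Ioo (0:ℝ) t, ‖g τ‖ ^ 2 * τ ^ α := by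
  rw [← auxPhi_image α t hα ht, integral_image_eq_integral_abs_deriv_smul measurableSet_Ioo
    (fun τ hτ => (auxPhi_deriv α t τ hτ.2).hasDerivWithinAt) (auxPhi_inj α t hα), ← integral_const_mul]
  exact setIntegral_congr_fun measurableSet_Ioo (fun τ hτ => auxH_sq α t τ g hα ht hτ)

theorem aux_Lc (α t : ℝ) (g : ℝ → ℂ) (hα : 0 < α) (ht : 0 < t) (z : ℂ) :
    Lc α t g z = ((t ^ (-α) * (α ^ α / (2 ^ α * Real.Gamma (α / 2))) : ℝ) : ℂ) * z *
      Complex.exp (-((α ^ 2 / 4 / t : ℝ) * z ^ (((2 / α : ℝ)) : ℂ))) *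
        auxLap (auxH α t g) (z ^ (((2 / α : ℝ)) : ℂ)) := by
  unfold Lc auxLap Kc
  rw [← auxPhi_image α t hα ht, integral_image_eq_integral_abs_deriv_smul measurableSet_Ioo
    (fun τ hτ => (auxPhi_deriv α t τ hτ.2).hasDerivWithinAt) (auxPhi_inj α t hα)]
  generalize z ^ (((2 / α : ℝ)) : ℂ) = w at *
  rw [Complex.ofReal_mul, mul_assoc, mul_assoc, mul_assoc]
  congr 1
  rw [← mul_assoc, ← mul_assoc, ← integral_const_mul]
  refine setIntegral_congr_fun measurableSet_Ioo (fun τ (hτ : τ ∈ Ioo 0 t) => ?_)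
  have h2 : t - τ ≠ 0 := by linarith [hτ.2]
  have h2' : (t : ℂ) - τ ≠ 0 := by exact_mod_cast h2
  have ht' : (t : ℂ) ≠ 0 := by exact_mod_cast ht.ne'
  rw [← smul_mul_assoc, auxH_pt α t τ g hα hτ]
  have e : Complex.exp (-(α ^ 2 : ℂ) * w / (4 * ((t - τ : ℝ) : ℂ))) =
      Complex.exp (-((α ^ 2 / 4 / t : ℝ) * w)) * Complex.exp (-((auxPhi α t τ : ℝ) * w)) := by
    rw [← Complex.exp_add]
    congr 1
    unfold auxPhi
    push_cast
    field_simp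
    ring
  rw [e, Complex.ofReal_mul (τ ^ α)]
  ring

theorem aux_cpow_re (p : ℝ) (z : ℂ) (hz : z ≠ 0) (h : |p * Complex.arg z| < Real.pi / 2) :
    0 < (z ^ (p : ℂ)).re := by
  rw [Complex.cpow_def_of_ne_zero hz, Complex.exp_re]
  have e : (Complex.log z * p).im = p * Complex.arg z := by
    rw [Complex.im_mul_ofReal, Complex.log_im]; ring
  rw [e]
  have := Real.cos_pos_of_mem_Ioo (abs_lt.1 h)
  positivity

theorem aux_cpow_cpow (p q : ℝ) (hpq : p * q = 1) (z : ℂ)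
    (h : |p * Complex.arg z| < Real.pi) : (z ^ (p : ℂ)) ^ (q : ℂ) = z := by
  have e : (Complex.log z * p).im = p * Complex.arg z := by
    rw [Complex.im_mul_ofReal, Complex.log_im]; ring
  rw [abs_lt] at h
  rw [← Complex.cpow_mul, ← Complex.ofReal_mul, hpq]
  · simp
  · rw [e]; exact h.1
  · rw [e]; exact h.2.le

theorem aux_arg_cpow (p : ℝ) (z : ℂ) (hz : z ≠ 0) (h : |p * Complex.arg z| < Real.pi) :
    Complex.arg (z ^ (p : ℂ)) = p * Complex.arg z := by
  have e : (Complex.log z * p).im = p * Complex.arg z := by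
    rw [Complex.im_mul_ofReal, Complex.log_im]; ring
  rw [abs_lt] at h
  rw [Complex.cpow_def_of_ne_zero hz, Complex.arg_exp, e, toIocMod_eq_self]
  constructor
  · exact h.1
  · linarith

theorem aux_sector_re (α : ℝ) (hα : 0 < α) (z : ℂ) (hz : z ∈ sector α) :
    0 < (z ^ (((2 / α : ℝ)) : ℂ)).re := by
  refine aux_cpow_re _ z hz.1 ?_
  rw [abs_mul, abs_of_pos (by positivity : 0 < 2 / α)]
  calc 2 / α * |z.arg| < 2 / α * (Real.pi * α / 4) := by gcongr; exact hz.2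
    _ = _ := by field_simp; norm_num

theorem aux_sector_slit (α : ℝ) (hα2 : α ≤ 2) (z : ℂ) (hz : z ∈ sector α) :
    z ∈ Complex.slitPlane := by
  rw [Complex.mem_slitPlane_iff_arg]
  refine ⟨fun h => ?_, hz.1⟩
  have h2 := hz.2
  rw [h, abs_of_pos Real.pi_pos] at h2
  nlinarith [Real.pi_pos]

theorem aux_image (α : ℝ) (hα : 0 < α) (hα2 : α ≤ 2) :
    (fun w : ℂ => w ^ ((α / 2 : ℝ) : ℂ)) '' {w : ℂ | 0 < w.re} = sector α := by
  have hpi := Real.pi_pos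
  ext z
  constructor
  · rintro ⟨w, hw, rfl⟩
    have hw : 0 < w.re := hw
    have hw0 : w ≠ 0 := by rintro rfl; simp at hw
    have ha : |w.arg| < Real.pi / 2 := Complex.abs_arg_lt_pi_div_two_iff.2 (Or.inl hw)
    have hb : |α / 2 * w.arg| < Real.pi * α / 4 := by
      rw [abs_mul, abs_of_pos (by positivity : 0 < α / 2)]
      calc α / 2 * |w.arg| < α / 2 * (Real.pi / 2) := by gcongr
        _ = _ := by ring
    refine ⟨by simp [Complex.cpow_eq_zero_iff, hw0], ?_⟩
    simp only
    rw [aux_arg_cpow _ w hw0 (by nlinarith)]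
    exact hb
  · intro hz
    refine ⟨z ^ (((2 / α : ℝ)) : ℂ), aux_sector_re α hα z hz, ?_⟩
    simp only
    refine aux_cpow_cpow _ _ (by field_simp) z ?_
    rw [abs_mul, abs_of_pos (by positivity : 0 < 2 / α)]
    calc 2 / α * |z.arg| < 2 / α * (Real.pi * α / 4) := by gcongr; exact hz.2
      _ = Real.pi / 2 := by field_simp; norm_num
      _ < Real.pi := by linarith

theorem aux_inv (α : ℝ) (hα : 0 < α) (hα2 : α ≤ 2) (w : ℂ) (hw : 0 < w.re) :
    (w ^ ((α / 2 : ℝ) : ℂ)) ^ (((2 / α : ℝ)) : ℂ) = w := by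
  have hpi := Real.pi_pos
  have hw0 : w ≠ 0 := by rintro rfl; simp at hw
  have ha : |w.arg| < Real.pi / 2 := Complex.abs_arg_lt_pi_div_two_iff.2 (Or.inl hw)
  refine aux_cpow_cpow _ _ (by field_simp) w ?_
  rw [abs_mul, abs_of_pos (by positivity : 0 < α / 2)]
  calc α / 2 * |w.arg| ≤ 1 * |w.arg| := by gcongr; linarith
    _ < Real.pi := by linarith

theorem aux_norm (p : ℝ) (w : ℂ) (hw : w ≠ 0) : ‖w ^ (p : ℂ)‖ = ‖w‖ ^ p := by
  rw [Complex.norm_cpow_of_ne_zero hw]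
  simp

theorem aux_cov (α : ℝ) (hα : 0 < α) (hα2 : α ≤ 2) (F : ℂ → ENNReal) :
    ∫⁻ z in sector α, F z = ∫⁻ w in {w : ℂ | 0 < w.re},
      ENNReal.ofReal ((α ^ 2 / 4) * ‖w‖ ^ (α - 2)) * F (w ^ ((α / 2 : ℝ) : ℂ)) := by
  have hU : MeasurableSet {w : ℂ | 0 < w.re} :=
    (isOpen_lt continuous_const Complex.continuous_re).measurableSet
  have hd : ∀ w ∈ {w : ℂ | 0 < w.re}, HasFDerivWithinAt (fun w : ℂ => w ^ ((α / 2 : ℝ) : ℂ))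
      ((ContinuousLinearMap.toSpanSingleton ℂ (((α / 2 : ℝ) : ℂ) * w ^ (((α / 2 : ℝ) : ℂ) - 1))).restrictScalars ℝ)
        {w : ℂ | 0 < w.re} w := by
    intro w hw
    have h := (hasDerivAt_id w).cpow_const (c := ((α / 2 : ℝ) : ℂ)) (Or.inl hw)
    simp only [mul_one] at h
    exact (h.hasFDerivAt.restrictScalars ℝ).hasFDerivWithinAt
  rw [← aux_image α hα hα2, lintegral_image_eq_lintegral_abs_det_fderiv_mul volume hU hd]
  · refine setLIntegral_congr_fun hU fun w hw => ?_
    have hw : 0 < w.re := hw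
    have hw0 : w ≠ 0 := by rintro rfl; simp at hw
    have hn : 0 < ‖w‖ := norm_pos_iff.2 hw0
    congr 2
    have e1 : ((α / 2 : ℝ) : ℂ) - 1 = ((α / 2 - 1 : ℝ) : ℂ) := by push_cast; ring
    have e2 : ‖w‖ ^ (α - 2) = (‖w‖ ^ (α / 2 - 1)) ^ 2 := by
      rw [← Real.rpow_natCast, ← Real.rpow_mul hn.le]; congr 1; push_cast; ring
    simp only [ContinuousLinearMap.det]
    rw [show ((((ContinuousLinearMap.toSpanSingleton ℂ (((α / 2 : ℝ) : ℂ) * w ^ (((α / 2 : ℝ) : ℂ) - 1))).restrictScalars ℝ) : ℂ →L[ℝ] ℂ) : ℂ →ₗ[ℝ] ℂ) = LinearMap.restrictScalars ℝ (LinearMap.toSpanSingleton ℂ ℂ (((α / 2 : ℝ) : ℂ) * w ^ (((α / 2 : ℝ) : ℂ) - 1))) from rfl]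
    rw [LinearMap.det_restrictScalars]
    simp only [Algebra.norm_complex_apply, Complex.normSq_eq_norm_sq]
    have e3 := aux_norm (α / 2 - 1) w hw0
    rw [abs_of_nonneg (by positivity), e1, e2, ← e3]
    have e4 : ∀ a : ℂ, LinearMap.det (LinearMap.toSpanSingleton ℂ ℂ a) = a := by intro a; simp
    simp only [e4, norm_mul, Complex.norm_real, Real.norm_eq_abs]
    rw [abs_of_pos (by positivity : 0 < α / 2)]
    ring
  · intro a ha b hb hab
    have hab : a ^ ((α / 2 : ℝ) : ℂ) = b ^ ((α / 2 : ℝ) : ℂ) := hab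
    rw [← aux_inv α hα hα2 a ha, hab, aux_inv α hα hα2 b hb]

theorem aux_Lc_diff (α t : ℝ) (hα : 0 < α) (hα2 : α ≤ 2) (ht : 0 < t)
    (g : ℝ → ℂ) (hg : Measurable g)
    (hint : IntegrableOn (fun τ => ‖g τ‖ ^ 2 * τ ^ α) (Set.Ioo 0 t)) :
    DifferentiableOn ℂ (Lc α t g) (sector α) := by
  intro z hz
  apply DifferentiableAt.differentiableWithinAt
  have hs := aux_sector_slit α hα2 z hz
  have h1 : DifferentiableAt ℂ (fun z : ℂ => z ^ (((2 / α : ℝ)) : ℂ)) z :=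
    differentiableAt_id.cpow_const hs
  have h2 : DifferentiableAt ℂ (fun z : ℂ => auxLap (auxH α t g) (z ^ (((2 / α : ℝ)) : ℂ))) z :=
    DifferentiableAt.comp (g := auxLap (auxH α t g)) z (aux_diff (auxH α t g) (auxH_meas α t g hg) α hα
      (auxH_integrable α t g hα ht hint) _ (aux_sector_re α hα z hz)) h1
  rw [funext (aux_Lc α t g hα ht)]
  exact ((differentiableAt_id.const_mul _).mul ((h1.const_mul _).neg.cexp)).mul h2

theorem aux_pointwise (α t : ℝ) (hα : 0 < α) (hα2 : α ≤ 2) (ht : 0 < t) (g : ℝ → ℂ)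
    (w : ℂ) (hw : 0 < w.re) :
    ((α ^ 2 / 4) * ‖w‖ ^ (α - 2)) * (‖Lc α t g (w ^ ((α / 2 : ℝ) : ℂ))‖ ^ 2 *
      muDens α t (w ^ ((α / 2 : ℝ) : ℂ))) =
    ((α ^ 2 / 4) * (t ^ (-α) * (α ^ α / (2 ^ α * Real.Gamma (α / 2)))) ^ 2 *
      ((Real.pi)⁻¹ * 2 ^ (α - 1) * betaFn (α / 2) (α / 2))) *
      (‖auxLap (auxH α t g) w‖ ^ 2 * w.re ^ (α - 1)) := by
  have hw0 : w ≠ 0 := by rintro rfl; simp at hw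
  have hn : 0 < ‖w‖ := norm_pos_iff.2 hw0
  have hG := Real.Gamma_pos_of_pos (half_pos hα)
  rw [aux_Lc α t g hα ht]
  unfold muDens
  rw [aux_inv α hα hα2 w hw]
  simp only [norm_mul, aux_norm _ w hw0, Complex.norm_exp, Complex.norm_real, Real.norm_eq_abs]
  rw [abs_of_pos (by positivity : 0 < t ^ (-α)),
    abs_of_pos (by positivity : 0 < (α ^ α / (2 ^ α * Real.Gamma (α / 2))))]
  have e1 : ‖w‖ ^ (α - 2) * (‖w‖ ^ (α / 2)) ^ 2 * (‖w‖ ^ (α / 2)) ^ (4 * (1 - α) / α) = 1 := by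
    rw [← Real.rpow_natCast, ← Real.rpow_mul hn.le, ← Real.rpow_mul hn.le, ← Real.rpow_add hn,
      ← Real.rpow_add hn]
    have : α - 2 + α / 2 * ((2 : ℕ) : ℝ) + α / 2 * (4 * (1 - α) / α) = 0 := by
      push_cast; field_simp; ring
    rw [this, Real.rpow_zero]
  have e2 : (-(((α ^ 2 / 4 / t : ℝ) : ℂ) * w)).re = -(α ^ 2 / 4 / t * w.re) := by
    rw [Complex.neg_re, Complex.re_ofReal_mul]
  rw [e2]
  have e3 : Real.exp (-(α ^ 2 / 4 / t * w.re)) ^ 2 * Real.exp (α ^ 2 / (2 * t) * w.re) = 1 := by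
    rw [← Real.exp_nat_mul, ← Real.exp_add]
    have : ((2 : ℕ) : ℝ) * -(α ^ 2 / 4 / t * w.re) + α ^ 2 / (2 * t) * w.re = 0 := by
      push_cast; field_simp; ring
    rw [this, Real.exp_zero]
  generalize ‖w‖ ^ (α - 2) = A at *
  generalize (‖w‖ ^ (α / 2)) ^ (4 * (1 - α) / α) = B at *
  generalize ‖w‖ ^ (α / 2) = D at *
  generalize Real.exp (-(α ^ 2 / 4 / t * w.re)) = E at *
  generalize Real.exp (α ^ 2 / (2 * t) * w.re) = F at *
  calc _ = (A * D ^ 2 * B) * (E ^ 2 * F) * (((α ^ 2 / 4) * (t ^ (-α) * (α ^ α / (2 ^ α * Real.Gamma (α / 2)))) ^ 2 *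
      ((Real.pi)⁻¹ * 2 ^ (α - 1) * betaFn (α / 2) (α / 2))) *
      (‖auxLap (auxH α t g) w‖ ^ 2 * w.re ^ (α - 1))) := by ring
    _ = _ := by rw [e1, e3]; ring

theorem aux_const (α t : ℝ) (hα : 0 < α) (ht : 0 < t) :
    ((α ^ 2 / 4) * (t ^ (-α) * (α ^ α / (2 ^ α * Real.Gamma (α / 2)))) ^ 2 *
      ((Real.pi)⁻¹ * 2 ^ (α - 1) * betaFn (α / 2) (α / 2))) *
      (2 * Real.pi * (Real.Gamma α * 2 ^ (-α) * ((α ^ 2 / 4) ^ (-1 - α) * t ^ α))) = t ^ (-α) := by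
  have hG := Real.Gamma_pos_of_pos (half_pos hα)
  have hG2 := Real.Gamma_pos_of_pos hα
  have hpi := Real.pi_pos
  unfold betaFn
  rw [add_halves]
  have e1 : (2:ℝ) ^ (α - 1) = 2 ^ α / 2 := by rw [Real.rpow_sub_one (by norm_num)]
  have e2 : (2:ℝ) ^ (-α) = (2 ^ α)⁻¹ := Real.rpow_neg (by norm_num) _
  have e3 : t ^ (-α) = (t ^ α)⁻¹ := Real.rpow_neg ht.le _
  have e4 : (α ^ 2 / 4) ^ (-1 - α) = (α ^ 2 / 4)⁻¹ * ((2 ^ α) ^ 2 / (α ^ α) ^ 2) := by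
    rw [sub_eq_add_neg, Real.rpow_add (by positivity), Real.rpow_neg_one, Real.rpow_neg (by positivity),
      show α ^ 2 / 4 = (α / 2) ^ 2 by ring, ← Real.rpow_natCast (α / 2) 2, ← Real.rpow_mul (by positivity),
      mul_comm ((2:ℕ):ℝ) α, Real.rpow_mul (by positivity) α, Real.rpow_natCast, Real.rpow_natCast,
      Real.div_rpow hα.le (by norm_num)]
    field_simp
  rw [e1, e2, e3, e4]
  field_simp

theorem stmt14 (α t : ℝ) (hα : 0 < α) (hα2 : α ≤ 2) (ht : 0 < t)
    (g : ℝ → ℂ) (hg : Measurable g)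
    (hint : IntegrableOn (fun τ => ‖g τ‖ ^ 2 * τ ^ α) (Set.Ioo 0 t)) :
    DifferentiableOn ℂ (Lc α t g) (sector α) ∧
    ∫ z in sector α, ‖Lc α t g z‖ ^ 2 * muDens α t z =
      t ^ (-α) * ∫ τ in Set.Ioo (0 : ℝ) t, ‖g τ‖ ^ 2 * τ ^ α := by
  have hd := aux_Lc_diff α t hα hα2 ht g hg hint
  refine ⟨hd, ?_⟩
  have hU : MeasurableSet {w : ℂ | 0 < w.re} :=
    (isOpen_lt continuous_const Complex.continuous_re).measurableSet
  have hS : MeasurableSet (sector α) := by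
    unfold sector
    refine MeasurableSet.inter (measurableSet_singleton (0:ℂ)).compl ?_
    exact measurableSet_lt (f := fun z : ℂ => |z.arg|) (Complex.measurable_arg.abs) measurable_const
  have hbeta : 0 < betaFn (α / 2) (α / 2) := by
    have hG := Real.Gamma_pos_of_pos (half_pos hα)
    have hG2 := Real.Gamma_pos_of_pos hα
    unfold betaFn
    rw [add_halves]
    positivity
  have hG := Real.Gamma_pos_of_pos (half_pos hα)
  have hG2 := Real.Gamma_pos_of_pos hα
  have hpi := Real.pi_pos
  have hN := auxH_integrable α t g hα ht hint
  rw [integral_eq_lintegral_of_nonneg_ae]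
  · rw [aux_cov α hα hα2]
    have e : ∀ w ∈ {w : ℂ | 0 < w.re}, ENNReal.ofReal ((α ^ 2 / 4) * ‖w‖ ^ (α - 2)) *
        ENNReal.ofReal (‖Lc α t g (w ^ ((α / 2 : ℝ) : ℂ))‖ ^ 2 * muDens α t (w ^ ((α / 2 : ℝ) : ℂ))) =
        ENNReal.ofReal ((α ^ 2 / 4) * (t ^ (-α) * (α ^ α / (2 ^ α * Real.Gamma (α / 2)))) ^ 2 *
      ((Real.pi)⁻¹ * 2 ^ (α - 1) * betaFn (α / 2) (α / 2))) *
      (‖auxLap (auxH α t g) w‖ₑ ^ 2 * ENNReal.ofReal (w.re ^ (α - 1))) := by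
      intro w hw
      rw [← ENNReal.ofReal_mul (by positivity), aux_pointwise α t hα hα2 ht g w hw,
        ENNReal.ofReal_mul (by positivity), ENNReal.ofReal_mul (p := ‖auxLap (auxH α t g) w‖ ^ 2) (by positivity),
        ENNReal.ofReal_pow (norm_nonneg _), ofReal_norm]
    rw [setLIntegral_congr_fun hU e, lintegral_const_mul' _ _ ENNReal.ofReal_ne_top,
      aux_main _ (auxH_meas α t g hg) α hα hN]
    have e2 : ∫⁻ v in Ioi (0:ℝ), ‖auxH α t g v‖ₑ ^ 2 * ENNReal.ofReal (v ^ (-α)) =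
        ENNReal.ofReal (∫ v in Ioi (0:ℝ), ‖auxH α t g v‖ ^ 2 * v ^ (-α)) := by
      rw [ofReal_integral_eq_lintegral_ofReal hN]
      · refine setLIntegral_congr_fun measurableSet_Ioi fun v hv => ?_
        rw [ENNReal.ofReal_mul (by positivity), ENNReal.ofReal_pow (norm_nonneg _), ofReal_norm]
      · refine (ae_restrict_mem measurableSet_Ioi).mono fun v hv => ?_
        have hv : 0 < v := hv
        simp only [Pi.zero_apply]
        positivity
    have hI : 0 ≤ ∫ τ in Set.Ioo (0 : ℝ) t, ‖g τ‖ ^ 2 * τ ^ α :=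
      setIntegral_nonneg measurableSet_Ioo fun τ hτ => by
        have := hτ.1
        positivity
    rw [e2, auxH_integral α t g hα ht, ← ENNReal.ofReal_mul (by positivity),
      ← ENNReal.ofReal_mul (by positivity), ← ENNReal.ofReal_mul (by positivity),
      ENNReal.toReal_ofReal (by positivity)]
    conv_rhs => rw [← aux_const α t hα ht]
    ring
  · refine (ae_restrict_mem hS).mono fun z hz => ?_
    have := aux_sector_re α hα z hz
    simp only [Pi.zero_apply]
    unfold muDens
    positivity
  · refine AEStronglyMeasurable.mul ((hd.continuousOn.aestronglyMeasurable hS).norm.pow 2) ?_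
    have : Measurable (muDens α t) := by
      unfold muDens
      fun_prop
    exact this.aestronglyMeasurable
end

section
/- Fix 0 < α ≤ 2 and t > 0. If F is holomorphic on the open sector Δ_α and ∫_{Δ_α} |F(z)|² dμ_α^t(z) < ∞, then there exists a measurable function g : (0,t) → ℂ with ∫_0^t |g(τ)|² τ^α dτ < ∞ such that F(z) = (L_t^α g)(z) for all z ∈ Δ_α. -/
open MeasureTheory Filter Set Complex

section Helpers
open scoped FourierTransform ENNReal Topology

/-- Holomorphic on the right half-plane with quadratic decay on vertical lines. -/
structure NiceHP (G : ℂ → ℂ) : Prop where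
  diff : DifferentiableOn ℂ G {w | 0 < w.re}
  bd : ∀ ε : ℝ, 0 < ε → ∃ C : ℝ, 0 ≤ C ∧ ∀ w : ℂ, ε ≤ w.re → ‖G w‖ ≤ C * (1 + w.im ^ 2)⁻¹

/-- Restriction to a vertical line. -/
noncomputable def vline (G : ℂ → ℂ) (u : ℝ) : ℝ → ℂ := fun v => G (u + v * I)

/-- The bilateral inverse Laplace integral. -/
noncomputable def lap (G : ℂ → ℂ) (u y : ℝ) : ℂ :=
  ∫ v : ℝ, cexp (2 * Real.pi * y * (u + v * I)) * G (u + v * I)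

lemma plancherel_aux {f : ℝ → ℂ} (hc : Continuous f) (hf : Integrable f)
    (hf' : Integrable (𝓕 f)) : ∫ y, (‖𝓕 f y‖ ^ 2 : ℝ) = ∫ v, (‖f v‖ ^ 2 : ℝ) := by
  have h : ∫ y, (innerSL ℂ) (𝓕 f y) (𝓕 f y) = ∫ x, (innerSL ℂ) (f x) (𝓕⁻ (𝓕 f) x) := by
    have h0 := VectorFourier.integral_sesq_fourierIntegral_eq_neg_flip (innerSL ℂ)
      Real.continuous_fourierChar (L := innerₗ ℝ) (μ := volume) (ν := volume) continuous_inner hf hf'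
    rw [flip_innerₗ] at h0
    exact h0
  rw [hc.fourierInv_fourier_eq hf hf'] at h
  simp only [innerSL_apply_apply, inner_self_eq_norm_sq_to_K] at h
  have h2 : ((∫ y, (‖𝓕 f y‖ ^ 2 : ℝ) : ℝ) : ℂ) = ((∫ v, (‖f v‖ ^ 2 : ℝ) : ℝ) : ℂ) := by
    rw [← integral_complex_ofReal, ← integral_complex_ofReal]
    simpa using h
  exact_mod_cast h2

lemma mem_hp {u v : ℝ} (hu : 0 < u) : (u + v * I : ℂ) ∈ {w : ℂ | 0 < w.re} := by
  simpa using hu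

lemma isOpen_hp : IsOpen {w : ℂ | 0 < w.re} := isOpen_lt continuous_const continuous_re

lemma NiceHP.vline_cont {G : ℂ → ℂ} (hG : NiceHP G) {u : ℝ} (hu : 0 < u) :
    Continuous (vline G u) := by
  apply hG.diff.continuousOn.comp_continuous (by fun_prop)
  intro v; exact mem_hp hu

lemma NiceHP.vline_bd {G : ℂ → ℂ} (hG : NiceHP G) {u : ℝ} (hu : 0 < u) :
    ∃ C : ℝ, 0 ≤ C ∧ ∀ u', u ≤ u' → ∀ v : ℝ, ‖vline G u' v‖ ≤ C * (1 + v ^ 2)⁻¹ := by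
  obtain ⟨C, hC, h⟩ := hG.bd u hu
  refine ⟨C, hC, fun u' hu' v => ?_⟩
  simpa [vline] using h (u' + v * I) (by simpa using hu')

lemma NiceHP.vline_int {G : ℂ → ℂ} (hG : NiceHP G) {u : ℝ} (hu : 0 < u) :
    Integrable (vline G u) := by
  obtain ⟨C, hC, h⟩ := hG.vline_bd hu
  exact (integrable_inv_one_add_sq.const_mul C).mono' (hG.vline_cont hu).aestronglyMeasurable
    (Eventually.of_forall (h u le_rfl))

lemma norm_exp_line (y u v : ℝ) :
    ‖cexp (2 * Real.pi * y * (u + v * I))‖ = Real.exp (2 * Real.pi * y * u) := by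
  rw [Complex.norm_exp]
  congr 1
  simp

lemma lap_eq (G : ℂ → ℂ) (u y : ℝ) :
    lap G u y = cexp (2 * Real.pi * y * u) * 𝓕⁻ (vline G u) y := by
  rw [Real.fourierInv_eq', ← integral_const_mul]
  apply integral_congr_ae
  refine Eventually.of_forall fun v => ?_
  simp only [vline, smul_eq_mul]
  rw [← mul_assoc, ← Complex.exp_add]
  congr 2
  simp
  ring

lemma NiceHP.lap_integrand_int {G : ℂ → ℂ} (hG : NiceHP G) {u : ℝ} (hu : 0 < u) (y : ℝ) :
    Integrable (fun v : ℝ => cexp (2 * Real.pi * y * (u + v * I)) * G (u + v * I)) := by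
  refine Integrable.bdd_mul (hG.vline_int hu) (c := Real.exp (2 * Real.pi * y * u)) ?_ ?_
  · exact Continuous.aestronglyMeasurable (by fun_prop)
  · exact Eventually.of_forall fun v => (norm_exp_line y u v).le

lemma NiceHP.lap_bd {G : ℂ → ℂ} (hG : NiceHP G) {u : ℝ} (hu : 0 < u) :
    ∃ C : ℝ, 0 ≤ C ∧ ∀ u', u ≤ u' → ∀ y : ℝ, ‖lap G u' y‖ ≤ C * Real.exp (2 * Real.pi * y * u') := by
  obtain ⟨C, hC, h⟩ := hG.vline_bd hu
  refine ⟨C * Real.pi, by positivity, fun u' hu' y => ?_⟩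
  have : ∀ v : ℝ, ‖cexp (2 * Real.pi * y * (u' + v * I)) * G (u' + v * I)‖ ≤
      Real.exp (2 * Real.pi * y * u') * (C * (1 + v ^ 2)⁻¹) := by
    intro v
    rw [norm_mul, norm_exp_line]
    gcongr
    exact h u' hu' v
  refine (norm_integral_le_of_norm_le ((integrable_inv_one_add_sq.const_mul C).const_mul _)
    (Eventually.of_forall this)).trans ?_
  rw [integral_const_mul, integral_const_mul, integral_univ_inv_one_add_sq]
  exact le_of_eq (by ring)

lemma NiceHP.lap_shift {G : ℂ → ℂ} (hG : NiceHP G) {a b : ℝ} (ha : 0 < a) (hab : a ≤ b) (y : ℝ) :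
    lap G a y = lap G b y := by
  have hb : 0 < b := ha.trans_le hab
  set f : ℂ → ℂ := fun w => cexp (2 * Real.pi * y * w) * G w with hf
  have hfd : DifferentiableOn ℂ f {w | 0 < w.re} := by
    apply DifferentiableOn.mul _ hG.diff
    fun_prop
  obtain ⟨C, hC, hCb⟩ := hG.bd a ha
  have rect : ∀ T : ℝ, (∫ x : ℝ in a..b, f (x + ((-T : ℝ) : ℂ) * I)) - (∫ x : ℝ in a..b, f (x + (T : ℂ) * I)) +
      I • (∫ v : ℝ in (-T)..T, f (b + v * I)) - I • (∫ v : ℝ in (-T)..T, f (a + v * I)) = 0 := by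
    intro T
    have := Complex.integral_boundary_rect_eq_zero_of_differentiableOn f (a + (-T : ℝ) * I) (b + T * I)
      (hfd.mono ?_)
    · simpa using this
    · intro w hw
      rw [Complex.mem_reProdIm] at hw
      have h1 := hw.1
      simp [Set.uIcc_of_le hab] at h1
      exact ha.trans_le h1.1
  have hor : ∀ s : ℝ, s = 1 ∨ s = -1 → Tendsto (fun T : ℝ => ∫ x : ℝ in a..b, f (x + ((s * T : ℝ) : ℂ) * I)) atTop (𝓝 0) := by
    intro s hs
    have hs2 : s ^ 2 = 1 := by rcases hs with rfl | rfl <;> norm_num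
    have key : ∀ T : ℝ, ‖∫ x : ℝ in a..b, f (x + ((s * T : ℝ) : ℂ) * I)‖ ≤
        (Real.exp (2 * Real.pi * |y| * b) * (C * (1 + T ^ 2)⁻¹)) * |b - a| := by
      intro T
      apply intervalIntegral.norm_integral_le_of_norm_le_const
      intro x hx
      rw [Set.uIoc_of_le hab] at hx
      rw [hf]
      simp only
      rw [norm_mul, norm_exp_line]
      have h1 := hCb (x + ((s * T : ℝ) : ℂ) * I) (by simpa using hx.1.le)
      have h2 : (x + ((s * T : ℝ) : ℂ) * I).im = s * T := by simp
      rw [h2, mul_pow, hs2, one_mul] at h1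
      gcongr
      · exact (ha.trans hx.1).le
      · exact le_abs_self y
      · exact hx.2
    refine squeeze_zero_norm key ?_
    have : Tendsto (fun T : ℝ => (1 + T ^ 2)⁻¹) atTop (𝓝 0) := by
      apply Tendsto.inv_tendsto_atTop
      apply tendsto_atTop_add_const_left
      exact tendsto_pow_atTop (by norm_num)
    simpa using ((this.const_mul C).const_mul (Real.exp (2 * Real.pi * |y| * b))).mul_const |b - a|
  have ver : ∀ u : ℝ, 0 < u → Tendsto (fun T : ℝ => ∫ v : ℝ in (-T)..T, f (u + v * I)) atTop (𝓝 (lap G u y)) := by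
    intro u hu
    exact intervalIntegral_tendsto_integral (hG.lap_integrand_int hu y) tendsto_neg_atTop_atBot tendsto_id
  have h1 := hor 1 (Or.inl rfl)
  have h2 := hor (-1) (Or.inr rfl)
  simp only [one_mul, neg_one_mul] at h1 h2
  have h3 := ((h2.sub h1).add ((ver b hb).const_smul I)).sub ((ver a ha).const_smul I)
  simp_rw [rect] at h3
  have h4 := tendsto_nhds_unique h3 tendsto_const_nhds
  simp only [sub_zero, zero_add, ← smul_sub, smul_eq_zero, I_ne_zero, false_or] at h4
  exact (sub_eq_zero.mp h4).symm

lemma NiceHP.lap_const {G : ℂ → ℂ} (hG : NiceHP G) {u : ℝ} (hu : 0 < u) (y : ℝ) :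
    lap G 1 y = lap G u y := by
  rcases le_total u 1 with h | h
  · exact (hG.lap_shift hu h y).symm
  · exact hG.lap_shift one_pos h y

lemma NiceHP.lap_neg {G : ℂ → ℂ} (hG : NiceHP G) {y : ℝ} (hy : y < 0) : lap G 1 y = 0 := by
  obtain ⟨C, hC, h⟩ := hG.lap_bd one_pos
  have h1 : ∀ᶠ u : ℝ in atTop, ‖lap G 1 y‖ ≤ C * Real.exp (2 * Real.pi * y * u) := by
    filter_upwards [eventually_ge_atTop 1] with u hu
    rw [hG.lap_const (one_pos.trans_le hu) y]
    exact h u hu y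
  have h2 : Tendsto (fun u : ℝ => C * Real.exp (2 * Real.pi * y * u)) atTop (𝓝 (C * 0)) := by
    apply Tendsto.const_mul
    apply Real.tendsto_exp_atBot.comp
    apply Tendsto.const_mul_atTop_of_neg _ tendsto_id
    have := Real.pi_pos
    nlinarith
  rw [mul_zero] at h2
  exact norm_le_zero_iff.mp (ge_of_tendsto h2 h1)

lemma NiceHP.inv_cont {G : ℂ → ℂ} (hG : NiceHP G) {u : ℝ} (hu : 0 < u) :
    Continuous (𝓕⁻ (vline G u)) := by
  have := VectorFourier.fourierIntegral_continuous Real.continuous_fourierChar (L := innerₗ ℝ) (μ := volume)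
      continuous_inner (hG.vline_int hu)
  have h2 : 𝓕⁻ (vline G u) = (fun y => 𝓕 (vline G u) (-y)) := by
    ext y; exact Real.fourierInv_eq_fourier_neg _ _
  rw [h2]
  exact Continuous.comp (g := 𝓕 (vline G u)) this continuous_neg

lemma NiceHP.lap_cont {G : ℂ → ℂ} (hG : NiceHP G) : Continuous (lap G 1) := by
  have : lap G 1 = fun y : ℝ => cexp (2 * Real.pi * y * (1 : ℝ)) * 𝓕⁻ (vline G 1) y := by
    ext y; exact lap_eq G 1 y
  rw [this]
  exact (by fun_prop : Continuous fun y : ℝ => cexp (2 * Real.pi * y * (1 : ℝ))).mul (hG.inv_cont one_pos)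

lemma NiceHP.inv_eq {G : ℂ → ℂ} (hG : NiceHP G) {u : ℝ} (hu : 0 < u) (y : ℝ) :
    𝓕⁻ (vline G u) y = cexp (-(2 * Real.pi * y * u)) * lap G 1 y := by
  rw [hG.lap_const hu, lap_eq, ← mul_assoc, ← Complex.exp_add]
  simp

lemma NiceHP.inv_int {G : ℂ → ℂ} (hG : NiceHP G) {u : ℝ} (hu : 0 < u) :
    Integrable (𝓕⁻ (vline G u)) := by
  obtain ⟨C, hC, h⟩ := hG.lap_bd (half_pos hu)
  have hi : IntegrableOn (fun y => C * Real.exp (-(Real.pi * u) * y)) (Ioi 0) :=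
    (exp_neg_integrableOn_Ioi 0 (by positivity)).const_mul C
  rw [← integrableOn_univ, ← Set.Iic_union_Ioi (a := (0:ℝ))]
  refine IntegrableOn.union ?_ ?_
  · rw [integrableOn_Iic_iff_integrableOn_Iio]
    refine (integrableOn_zero).congr_fun (f := fun _ => (0:ℂ)) ?_ measurableSet_Iio
    intro y hy
    simp only
    rw [hG.inv_eq hu, hG.lap_neg hy, mul_zero]
  · refine hi.mono' (hG.inv_cont hu).aestronglyMeasurable.restrict ?_
    refine Eventually.of_forall fun y => ?_
    rw [hG.inv_eq hu, hG.lap_const (half_pos hu), norm_mul, Complex.norm_exp]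
    calc _ ≤ Real.exp (-(2 * Real.pi * y * u)) * (C * Real.exp (2 * Real.pi * y * (u / 2))) := by
          gcongr
          · simp
          · exact h _ le_rfl y
      _ = _ := by
          rw [mul_left_comm, ← Real.exp_add]
          congr 2; ring

lemma NiceHP.fourier_int {G : ℂ → ℂ} (hG : NiceHP G) {u : ℝ} (hu : 0 < u) :
    Integrable (𝓕 (vline G u)) := by
  have := (hG.inv_int hu).comp_neg
  refine this.congr (Eventually.of_forall fun y => ?_)
  simp only
  rw [Real.fourierInv_eq_fourier_neg, neg_neg]

lemma NiceHP.inversion {G : ℂ → ℂ} (hG : NiceHP G) {w : ℂ} (hw : 0 < w.re) :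
    IntegrableOn (fun y : ℝ => cexp (-(2 * Real.pi * y * w)) * lap G 1 y) (Ioi 0) ∧
    G w = ∫ y in Ioi (0:ℝ), cexp (-(2 * Real.pi * y * w)) * lap G 1 y := by
  have h := congrFun ((hG.vline_cont hw).fourier_fourierInv_eq (hG.vline_int hw) (hG.fourier_int hw)) w.im
  have h0 : vline G w.re w.im = G w := by simp [vline]
  have hE : ∀ y : ℝ, cexp (↑(-2 * Real.pi * y * w.im) * I) • 𝓕⁻ (vline G w.re) y =
      cexp (-(2 * Real.pi * y * w)) * lap G 1 y := by
    intro y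
    rw [hG.inv_eq hw, smul_eq_mul, ← mul_assoc, ← Complex.exp_add]
    congr 2
    conv_rhs => rw [← re_add_im w]
    push_cast
    ring
  rw [h0, Real.fourier_real_eq_integral_exp_smul] at h
  simp_rw [hE] at h
  have hI : Integrable (fun y : ℝ => cexp (-(2 * Real.pi * y * w)) * lap G 1 y) := by
    simp_rw [← hE]
    refine Integrable.bdd_mul (hG.inv_int hw) (c := 1) ?_ ?_
    · exact Continuous.aestronglyMeasurable (by fun_prop)
    · refine Eventually.of_forall fun y => ?_
      rw [Complex.norm_exp_ofReal_mul_I]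
  refine ⟨hI.integrableOn, ?_⟩
  rw [← h, ← integral_Ici_eq_integral_Ioi]
  refine (setIntegral_eq_integral_of_forall_compl_eq_zero ?_).symm
  intro y hy
  rw [hG.lap_neg (by simpa using hy), mul_zero]

lemma NiceHP.planch {G : ℂ → ℂ} (hG : NiceHP G) {u : ℝ} (hu : 0 < u) :
    ∫⁻ y, ENNReal.ofReal (‖lap G 1 y‖ ^ 2 * Real.exp (-(4 * Real.pi * y * u))) =
      ∫⁻ v : ℝ, ENNReal.ofReal (‖G (u + v * I)‖ ^ 2) := by
  have h1 := plancherel_aux (hG.vline_cont hu) (hG.vline_int hu) (hG.fourier_int hu)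
  rw [← integral_neg_eq_self] at h1
  have hE : ∀ y : ℝ, ‖𝓕 (vline G u) (-y)‖ ^ 2 = ‖lap G 1 y‖ ^ 2 * Real.exp (-(4 * Real.pi * y * u)) := by
    intro y
    rw [← Real.fourierInv_eq_fourier_neg, hG.inv_eq hu, norm_mul, mul_pow, Complex.norm_exp,
      ← Real.exp_nat_mul, mul_comm]
    congr 2
    simp
    ring
  simp_rw [hE] at h1
  obtain ⟨C, hC, hb⟩ := hG.vline_bd hu
  obtain ⟨C', hC', hb'⟩ := hG.lap_bd hu
  have i1 : Integrable (fun v => ‖vline G u v‖ ^ 2) := by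
    refine ((hG.vline_int hu).norm.const_mul C).mono' ((hG.vline_cont hu).norm.pow 2).aestronglyMeasurable
      (Eventually.of_forall fun v => ?_)
    rw [Real.norm_of_nonneg (by positivity), sq]
    gcongr
    refine (hb u le_rfl v).trans (mul_le_of_le_one_right hC ?_)
    apply inv_le_one_of_one_le₀
    nlinarith [sq_nonneg v]
  have i2 : Integrable (fun y => ‖𝓕⁻ (vline G u) y‖ ^ 2) := by
    refine ((hG.inv_int hu).norm.const_mul C').mono' ((hG.inv_cont hu).norm.pow 2).aestronglyMeasurable
      (Eventually.of_forall fun v => ?_)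
    rw [Real.norm_of_nonneg (by positivity), sq]
    gcongr
    rw [hG.inv_eq hu, hG.lap_const hu, norm_mul, Complex.norm_exp]
    calc _ ≤ Real.exp (-(2 * Real.pi * v * u)) * (C' * Real.exp (2 * Real.pi * v * u)) := by
          gcongr
          · simp
          · exact hb' _ le_rfl v
      _ = _ := by
          rw [mul_left_comm, ← Real.exp_add]
          simp
  have i3 : Integrable (fun y => ‖lap G 1 y‖ ^ 2 * Real.exp (-(4 * Real.pi * y * u))) := by
    refine i2.congr (Eventually.of_forall fun y => ?_)
    simp only
    rw [Real.fourierInv_eq_fourier_neg, hE]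
  rw [← ofReal_integral_eq_lintegral_ofReal i3 (Eventually.of_forall fun y => by positivity), h1,
    ofReal_integral_eq_lintegral_ofReal i1 (Eventually.of_forall fun y => by positivity)]
  rfl


lemma measurable_ind {g : ℂ → ℝ≥0∞} (hg : ContinuousOn g {w : ℂ | 0 < w.re}) :
    Measurable (indicator {w : ℂ | 0 < w.re} g) := by
  classical
  rw [← Set.piecewise_eq_indicator]
  exact ContinuousOn.measurable_piecewise hg continuousOn_const isOpen_hp.measurableSet

lemma lintegral_hp {g : ℂ → ℝ≥0∞} (hg : ContinuousOn g {w : ℂ | 0 < w.re}) :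
    ∫⁻ w in {w : ℂ | 0 < w.re}, g w = ∫⁻ u in Ioi (0:ℝ), ∫⁻ v : ℝ, g (u + v * I) := by
  rw [← lintegral_indicator isOpen_hp.measurableSet,
    ← (volume_preserving_equiv_real_prod.symm).lintegral_comp_emb
      measurableEquivRealProd.symm.measurableEmbedding, Measure.volume_eq_prod,
    lintegral_prod (fun a => {w : ℂ | 0 < w.re}.indicator g (measurableEquivRealProd.symm a))
      ((measurable_ind hg).comp measurableEquivRealProd.symm.measurable).aemeasurable,
    ← lintegral_indicator measurableSet_Ioi]
  congr 1
  ext u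
  by_cases hu : 0 < u
  · rw [indicator_of_mem (by exact hu)]
    congr 1
    ext v
    have : measurableEquivRealProd.symm (u, v) = (u + v * I : ℂ) := by
      apply Complex.ext <;> simp [measurableEquivRealProd, equivRealProd]
    rw [this, indicator_of_mem (mem_hp hu)]
  · rw [indicator_of_notMem (by exact hu)]
    rw [lintegral_eq_zero_iff' ]
    · refine Eventually.of_forall fun v => ?_
      apply indicator_of_notMem
      have : (measurableEquivRealProd.symm (u, v)).re = u := by
        simp [measurableEquivRealProd, equivRealProd]
      simpa [this] using hu
    · exact ((measurable_ind hg).comp (measurableEquivRealProd.symm.measurable.comp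
        measurable_prodMk_left)).aemeasurable

/-- weighted squared norm -/
noncomputable def wn (α : ℝ) (G : ℂ → ℂ) : ℝ≥0∞ :=
  ∫⁻ w in {w : ℂ | 0 < w.re}, ENNReal.ofReal (‖G w‖ ^ 2 * w.re ^ (α - 1))

lemma wn_cont {α : ℝ} {G : ℂ → ℂ} (hG : ContinuousOn G {w : ℂ | 0 < w.re}) :
    ContinuousOn (fun w : ℂ => ENNReal.ofReal (‖G w‖ ^ 2 * w.re ^ (α - 1))) {w : ℂ | 0 < w.re} := by
  apply ENNReal.continuous_ofReal.comp_continuousOn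
  apply ContinuousOn.mul (hG.norm.pow 2)
  apply ContinuousOn.rpow_const continuous_re.continuousOn
  intro w hw; left; exact ne_of_gt hw

lemma NiceHP.norm_est {α : ℝ} (hα : 0 < α) {G : ℂ → ℂ} (hG : NiceHP G) :
    ∫⁻ y in Ioi (0:ℝ), ENNReal.ofReal (‖lap G 1 y‖ ^ 2 * ((1 / (4 * Real.pi * y)) ^ α * Real.Gamma α)) ≤
      wn α G := by
  rw [wn, lintegral_hp (wn_cont hG.diff.continuousOn)]
  have h1 : ∫⁻ u in Ioi (0:ℝ), ∫⁻ v : ℝ, ENNReal.ofReal (‖G (u + v * I)‖ ^ 2 * (u + v * I : ℂ).re ^ (α - 1)) =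
      ∫⁻ u in Ioi (0:ℝ), ∫⁻ y : ℝ, ENNReal.ofReal (u ^ (α - 1)) *
        ENNReal.ofReal (‖lap G 1 y‖ ^ 2 * Real.exp (-(4 * Real.pi * y * u))) := by
    refine setLIntegral_congr_fun measurableSet_Ioi fun u hu => ?_
    have hu : 0 < u := hu
    rw [lintegral_const_mul' _ _ ENNReal.ofReal_ne_top, hG.planch hu,
      ← lintegral_const_mul' _ _ ENNReal.ofReal_ne_top]
    congr 1; ext v
    rw [← ENNReal.ofReal_mul (by positivity), mul_comm]
    simp
  rw [h1, lintegral_lintegral_swap]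
  · refine le_trans ?_ (setLIntegral_le_lintegral (Ioi (0:ℝ)) _)
    refine setLIntegral_mono' measurableSet_Ioi fun y hy => ?_
    have hy : 0 < y := hy
    rw [← Real.integral_rpow_mul_exp_neg_mul_Ioi hα (r := 4 * Real.pi * y) (by positivity),
      ← integral_const_mul, ofReal_integral_eq_lintegral_ofReal]
    · refine le_of_eq (setLIntegral_congr_fun measurableSet_Ioi fun u hu => ?_)
      have hu : 0 < u := hu
      rw [← ENNReal.ofReal_mul (by positivity)]
      congr 1
      ring
    · apply Integrable.const_mul
      have := Real.GammaIntegral_convergent hα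
      have h2 := integrableOn_rpow_mul_exp_neg_mul_rpow (p := 1) (s := α - 1) (b := 4 * Real.pi * y)
        (by linarith) (by norm_num) (by positivity)
      simpa [IntegrableOn] using h2
    · refine (ae_restrict_mem measurableSet_Ioi).mono fun u hu => ?_
      have hu : 0 < u := hu
      simp only [Pi.zero_apply]; positivity
  · apply Measurable.aemeasurable
    have := hG.lap_cont.measurable
    fun_prop

lemma circle_mean {G : ℂ → ℂ} (hG : DifferentiableOn ℂ G {w : ℂ | 0 < w.re}) {w : ℂ} {r : ℝ}
    (hr : 0 < r) (hrw : r < w.re) :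
    ENNReal.ofReal (2 * Real.pi * ‖G w‖ ^ 2) ≤
      ∫⁻ θ in Ioo (-Real.pi) Real.pi, ENNReal.ofReal (‖G (circleMap w r θ)‖ ^ 2) := by
  have hsub : Metric.closedBall w |r| ⊆ {w : ℂ | 0 < w.re} := by
    intro z hz
    rw [Metric.mem_closedBall, dist_eq, abs_of_pos hr] at hz
    have := (abs_le.mp ((abs_re_le_norm (z - w)).trans hz)).1
    simp only [sub_re, mem_ofPred_eq] at *
    linarith
  have hd : DiffContOnCl ℂ (fun z => G z ^ 2) (Metric.ball w |r|) := by
    apply DifferentiableOn.diffContOnCl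
    rw [closure_ball _ (by simpa using hr.ne')]
    exact (hG.mono hsub).pow 2
  have hm := hd.circleAverage
  rw [Real.circleAverage_def] at hm
  have hcirc : ∀ θ, circleMap w r θ ∈ {w : ℂ | 0 < w.re} := fun θ =>
    hsub (Metric.sphere_subset_closedBall (circleMap_mem_sphere' w r θ))
  have hcont : Continuous fun θ => G (circleMap w r θ) :=
    hG.continuousOn.comp_continuous (continuous_circleMap w r) hcirc
  have hper : Function.Periodic (fun θ => G (circleMap w r θ) ^ 2) (2 * Real.pi) := by
    intro θ; simp only [periodic_circleMap w r θ]
  have h2 := hper.intervalIntegral_add_eq 0 (-Real.pi)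
  rw [zero_add, show -Real.pi + 2 * Real.pi = Real.pi by ring] at h2
  rw [h2] at hm
  have h3 : 2 * Real.pi * ‖G w‖ ^ 2 ≤ ∫ θ in Ioo (-Real.pi) Real.pi, ‖G (circleMap w r θ)‖ ^ 2 := by
    rw [← integral_Ioc_eq_integral_Ioo, ← intervalIntegral.integral_of_le (by linarith [Real.pi_pos]),
      ← norm_pow, ← hm, norm_smul, Real.norm_of_nonneg (by positivity), ← mul_assoc,
      mul_inv_cancel₀ (by positivity), one_mul]
    refine (intervalIntegral.norm_integral_le_integral_norm (by linarith [Real.pi_pos])).trans ?_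
    simp
  refine (ENNReal.ofReal_le_ofReal h3).trans (le_of_eq ?_)
  apply ofReal_integral_eq_lintegral_ofReal
  · exact ((hcont.norm.pow 2).integrableOn_Icc).mono_set Ioo_subset_Icc_self
  · exact Eventually.of_forall fun _ => by positivity

lemma area_mean {G : ℂ → ℂ} (hG : DifferentiableOn ℂ G {w : ℂ | 0 < w.re}) {w : ℂ} {R : ℝ}
    (hR : 0 < R) (hRw : R < w.re) :
    ENNReal.ofReal (Real.pi * R ^ 2 * ‖G w‖ ^ 2) ≤
      ∫⁻ z in Metric.ball w R, ENNReal.ofReal (‖G z‖ ^ 2) := by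
  set q : ℂ → ℝ≥0∞ := indicator {w : ℂ | 0 < w.re} (fun z => ENNReal.ofReal (‖G z‖ ^ 2)) with hq
  have hqm : Measurable q := measurable_ind (by
    apply ENNReal.continuous_ofReal.comp_continuousOn
    exact hG.continuousOn.norm.pow 2)
  have hsub : Metric.ball w R ⊆ {w : ℂ | 0 < w.re} := by
    intro z hz
    rw [Metric.mem_ball, dist_eq] at hz
    have := (abs_lt.mp ((abs_re_le_norm (z - w)).trans_lt hz)).1
    simp only [sub_re, mem_ofPred_eq] at *
    linarith
  have e1 : ∫⁻ z in Metric.ball w R, ENNReal.ofReal (‖G z‖ ^ 2) = ∫⁻ z in Metric.ball w R, q z := by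
    refine setLIntegral_congr_fun measurableSet_ball fun z hz => ?_
    rw [hq, indicator_of_mem (hsub hz)]
  rw [e1, ← lintegral_indicator measurableSet_ball, ← lintegral_add_left_eq_self _ w,
    ← Complex.lintegral_comp_polarCoord_symm, polarCoord_target, Measure.volume_eq_prod,
    ← Measure.prod_restrict, lintegral_prod]
  · calc ENNReal.ofReal (Real.pi * R ^ 2 * ‖G w‖ ^ 2)
        = ∫⁻ r in Ioo 0 R, ENNReal.ofReal (r * (2 * Real.pi * ‖G w‖ ^ 2)) := by
          rw [← ofReal_integral_eq_lintegral_ofReal]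
          · congr 1
            rw [← integral_Ioc_eq_integral_Ioo, ← intervalIntegral.integral_of_le hR.le,
              intervalIntegral.integral_mul_const, integral_id]
            ring
          · exact (Continuous.integrableOn_Icc (by fun_prop)).mono_set Ioo_subset_Icc_self
          · refine (ae_restrict_mem measurableSet_Ioo).mono fun r hr => ?_
            have := hr.1
            simp only [Pi.zero_apply]; positivity
      _ ≤ ∫⁻ r in Ioo 0 R, ∫⁻ θ in Ioo (-Real.pi) Real.pi, ENNReal.ofReal (r, θ).1 •
            (Metric.ball w R).indicator q (w + Complex.polarCoord.symm (r, θ)) := by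
          refine setLIntegral_mono' measurableSet_Ioo fun r hr => ?_
          rw [ENNReal.ofReal_mul hr.1.le]
          simp only [smul_eq_mul]
          rw [lintegral_const_mul' _ _ ENNReal.ofReal_ne_top]
          gcongr
          refine (circle_mean hG hr.1 (hr.2.trans hRw)).trans (le_of_eq ?_)
          congr 1; ext θ
          have hθ : w + Complex.polarCoord.symm (r, θ) = circleMap w r θ := by
            rw [Complex.polarCoord_symm_apply, circleMap, Complex.exp_mul_I]
            simp
          have hm : circleMap w r θ ∈ Metric.ball w R := by
            rw [Metric.mem_ball, dist_eq, circleMap]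
            simpa [abs_of_pos hr.1] using hr.2
          rw [hθ, indicator_of_mem hm, hq, indicator_of_mem (hsub hm)]
      _ ≤ _ := lintegral_mono_set Ioo_subset_Ioi_self
  · apply Measurable.aemeasurable
    have h1 : Measurable ((Metric.ball w R).indicator q) := hqm.indicator measurableSet_ball
    simp only [Complex.polarCoord_symm_apply, smul_eq_mul]
    refine Measurable.mul (by fun_prop) (h1.comp (by fun_prop))

lemma ptwise_bd {α : ℝ} (hα : 0 < α) {G : ℂ → ℂ} (hG : DifferentiableOn ℂ G {w : ℂ | 0 < w.re})
    (hfin : wn α G ≠ ∞) {ε : ℝ} (hε : 0 < ε) :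
    ∃ C : ℝ, 0 ≤ C ∧ ∀ w : ℂ, ε ≤ w.re → ‖G w‖ ≤ C := by
  refine ⟨√(3 * (wn α G).toReal / (Real.pi * (ε / 2) ^ (α + 1))), Real.sqrt_nonneg _, fun w hw => ?_⟩
  apply Real.le_sqrt_of_sq_le
  have hpos : 0 < w.re := hε.trans_le hw
  set R := w.re / 2 with hR
  have hR0 : 0 < R := by positivity
  have h1 := area_mean hG hR0 (by linarith : R < w.re)
  have hball : ∀ z ∈ Metric.ball w R, R ≤ z.re ∧ z.re ≤ 3 * R := by
    intro z hz
    rw [Metric.mem_ball, dist_eq] at hz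
    have := (abs_lt.mp ((abs_re_le_norm (z - w)).trans_lt hz))
    simp only [sub_re] at this
    constructor <;> linarith
  have h2 : ENNReal.ofReal (R ^ (α - 1) / 3) * ∫⁻ z in Metric.ball w R, ENNReal.ofReal (‖G z‖ ^ 2) ≤ wn α G := by
    rw [← lintegral_const_mul' _ _ ENNReal.ofReal_ne_top]
    refine le_trans (setLIntegral_mono' measurableSet_ball fun z hz => ?_)
      (lintegral_mono_set (fun z hz => hR0.trans_le (hball z hz).1))
    obtain ⟨ha, hb⟩ := hball z hz
    rw [← ENNReal.ofReal_mul (by positivity), mul_comm]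
    apply ENNReal.ofReal_le_ofReal
    gcongr
    have hx : 1 ≤ z.re / R := by rwa [one_le_div hR0]
    have hx3 : z.re / R ≤ 3 := by rwa [div_le_iff₀ hR0]
    have : z.re ^ (α - 1) = R ^ (α - 1) * (z.re / R) ^ (α - 1) := by
      rw [← Real.mul_rpow hR0.le (by positivity)]
      congr 1; field_simp
    rw [this, div_eq_mul_inv]
    gcongr
    calc (3:ℝ)⁻¹ ≤ (z.re / R)⁻¹ := by gcongr
      _ = (z.re / R) ^ (-1 : ℝ) := (Real.rpow_neg_one _).symm
      _ ≤ _ := Real.rpow_le_rpow_of_exponent_le hx (by linarith)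
  have h3 := (mul_le_mul_right h1 (ENNReal.ofReal (R ^ (α - 1) / 3))).trans h2
  rw [← ENNReal.ofReal_mul (by positivity)] at h3
  have h4 := (ENNReal.ofReal_le_iff_le_toReal hfin).mp h3
  have h5 : R ^ (α + 1) = R ^ (α - 1) * R ^ 2 := by
    rw [← Real.rpow_natCast, ← Real.rpow_add hR0]; congr 1; push_cast; ring
  have h6 : (ε / 2) ^ (α + 1) ≤ R ^ (α + 1) := by
    apply Real.rpow_le_rpow (by positivity) (by linarith) (by linarith)
  rw [le_div_iff₀ (by positivity)]
  calc ‖G w‖ ^ 2 * (Real.pi * (ε / 2) ^ (α + 1)) ≤ ‖G w‖ ^ 2 * (Real.pi * R ^ (α + 1)) := by gcongr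
    _ = 3 * (R ^ (α - 1) / 3 * (Real.pi * R ^ 2 * ‖G w‖ ^ 2)) := by rw [h5]; ring
    _ ≤ _ := by gcongr


/-- Regularization. -/
noncomputable def reg (G : ℂ → ℂ) (n : ℕ) : ℂ → ℂ :=
  fun w => G w / (1 + ((1 / ((n:ℝ) + 1) : ℝ) : ℂ) * w) ^ 2

lemma reg_den {δ : ℝ} (hδ : 0 < δ) {w : ℂ} (hw : 0 < w.re) :
    1 + δ ^ 2 * w.im ^ 2 ≤ ‖(1 + (δ : ℂ) * w) ^ 2‖ := by
  rw [norm_pow, Complex.sq_norm, Complex.normSq_apply]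
  simp
  have := mul_pos hδ hw
  nlinarith

lemma reg_den_ne {δ : ℝ} (hδ : 0 < δ) {w : ℂ} (hw : 0 < w.re) : (1 + (δ : ℂ) * w) ^ 2 ≠ 0 := by
  have := reg_den hδ hw
  rw [← norm_pos_iff]
  refine lt_of_lt_of_le ?_ this
  positivity

lemma reg_diff {G : ℂ → ℂ} (hG : DifferentiableOn ℂ G {w : ℂ | 0 < w.re}) (n : ℕ) :
    DifferentiableOn ℂ (reg G n) {w : ℂ | 0 < w.re} := by
  apply DifferentiableOn.div hG (by fun_prop)
  intro w hw
  exact reg_den_ne (by positivity) hw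

lemma reg_le (G : ℂ → ℂ) (n : ℕ) {w : ℂ} (hw : 0 < w.re) : ‖reg G n w‖ ≤ ‖G w‖ := by
  rw [reg, norm_div]
  apply div_le_self (norm_nonneg _)
  have := reg_den (δ := 1 / ((n:ℝ) + 1)) (by positivity) hw
  have h2 : 0 ≤ (1 / ((n:ℝ) + 1)) ^ 2 * w.im ^ 2 := by positivity
  linarith

lemma reg_tendsto (G : ℂ → ℂ) (w : ℂ) : Tendsto (fun n => reg G n w) atTop (𝓝 (G w)) := by
  have h := (continuous_ofReal.tendsto 0).comp (tendsto_one_div_add_atTop_nhds_zero_nat (𝕜 := ℝ))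
  have h2 : Tendsto (fun n : ℕ => G w / (1 + ((1 / ((n:ℝ) + 1) : ℝ) : ℂ) * w) ^ 2) atTop
      (𝓝 (G w / (1 + ((0 : ℝ) : ℂ) * w) ^ 2)) := by
    apply Tendsto.div tendsto_const_nhds
    · exact ((h.mul_const w).const_add 1).pow 2
    · simp
  simpa [reg] using h2

lemma reg_nice {α : ℝ} (hα : 0 < α) {G : ℂ → ℂ} (hG : DifferentiableOn ℂ G {w : ℂ | 0 < w.re})
    (hfin : wn α G ≠ ∞) (n : ℕ) : NiceHP (reg G n) := by
  refine ⟨reg_diff hG n, fun ε hε => ?_⟩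
  obtain ⟨C, hC, hb⟩ := ptwise_bd hα hG hfin hε
  set δ : ℝ := 1 / ((n:ℝ) + 1) with hδ
  have hδ0 : 0 < δ := by positivity
  have hδ1 : δ ≤ 1 := by
    rw [hδ, div_le_one (by positivity)]
    have : (0:ℝ) ≤ n := by positivity
    linarith
  refine ⟨C / δ ^ 2, by positivity, fun w hw => ?_⟩
  have h1 := reg_den hδ0 (hε.trans_le hw)
  rw [reg, norm_div, ← div_eq_mul_inv, div_div]
  gcongr
  · exact hb w hw
  · refine le_trans ?_ h1
    nlinarith

lemma NiceHP.sub {G H : ℂ → ℂ} (hG : NiceHP G) (hH : NiceHP H) : NiceHP (fun w => G w - H w) := by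
  refine ⟨hG.diff.sub hH.diff, fun ε hε => ?_⟩
  obtain ⟨C, hC, hb⟩ := hG.bd ε hε
  obtain ⟨D, hD, hb'⟩ := hH.bd ε hε
  refine ⟨C + D, by positivity, fun w hw => ?_⟩
  rw [add_mul]
  exact (norm_sub_le _ _).trans (add_le_add (hb w hw) (hb' w hw))

lemma NiceHP.lap_sub {G H : ℂ → ℂ} (hG : NiceHP G) (hH : NiceHP H) (y : ℝ) :
    lap (fun w => G w - H w) 1 y = lap G 1 y - lap H 1 y := by
  unfold lap
  rw [← integral_sub (hG.lap_integrand_int one_pos y) (hH.lap_integrand_int one_pos y)]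
  congr 1; ext v; ring

/-- the weighted boundary function -/
noncomputable def kfun (α : ℝ) (G : ℂ → ℂ) (y : ℝ) : ℂ := ((y ^ (-(α / 2)) : ℝ) : ℂ) * lap G 1 y

lemma NiceHP.kfun_meas (α : ℝ) {G : ℂ → ℂ} (hG : NiceHP G) : Measurable (kfun α G) := by
  have := hG.lap_cont.measurable
  unfold kfun
  fun_prop

lemma NiceHP.kfun_est {α : ℝ} (hα : 0 < α) {G : ℂ → ℂ} (hG : NiceHP G) :
    ∫⁻ y in Ioi (0:ℝ), ‖kfun α G y‖ₑ ^ (2:ℝ) ≤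
      ENNReal.ofReal ((4 * Real.pi) ^ α / Real.Gamma α) * wn α G := by
  have hΓ := Real.Gamma_pos_of_pos hα
  refine le_trans (le_of_eq ?_) (mul_le_mul_right (hG.norm_est hα) _)
  rw [← lintegral_const_mul' _ _ ENNReal.ofReal_ne_top]
  refine setLIntegral_congr_fun measurableSet_Ioi fun y hy => ?_
  have hy : 0 < y := hy
  rw [← ENNReal.ofReal_mul (by positivity), ← ofReal_norm,
    ENNReal.ofReal_rpow_of_nonneg (by positivity) (by norm_num)]
  congr 1
  rw [kfun, norm_mul, Complex.norm_real, Real.norm_of_nonneg (by positivity), Real.rpow_two, mul_pow,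
    ← Real.rpow_natCast, ← Real.rpow_mul hy.le, Real.div_rpow (by positivity) (by positivity),
    Real.mul_rpow (by positivity) hy.le, Real.one_rpow]
  rw [show -(α / 2) * ((2:ℕ):ℝ) = -α by push_cast; ring, Real.rpow_neg hy.le]
  field_simp

lemma NiceHP.kfun_mem {α : ℝ} (hα : 0 < α) {G : ℂ → ℂ} (hG : NiceHP G) (hfin : wn α G ≠ ∞) :
    MemLp (kfun α G) 2 (volume.restrict (Ioi 0)) := by
  refine ⟨(hG.kfun_meas α).aestronglyMeasurable, ?_⟩
  rw [eLpNorm_lt_top_iff_lintegral_rpow_enorm_lt_top (by norm_num) (by norm_num)]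
  refine lt_of_le_of_lt (by simpa using hG.kfun_est hα) ?_
  exact ENNReal.mul_lt_top ENNReal.ofReal_lt_top hfin.lt_top

lemma NiceHP.kfun_dist {α : ℝ} (hα : 0 < α) {G H : ℂ → ℂ} (hG : NiceHP G) (hH : NiceHP H) :
    eLpNorm (kfun α G - kfun α H) 2 (volume.restrict (Ioi 0)) ≤
      (ENNReal.ofReal ((4 * Real.pi) ^ α / Real.Gamma α) * wn α (fun w => G w - H w)) ^ (1 / 2 : ℝ) := by
  have h : kfun α G - kfun α H = kfun α (fun w => G w - H w) := by
    ext y; simp only [Pi.sub_apply, kfun, hG.lap_sub hH]; ring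
  rw [h, eLpNorm_eq_lintegral_rpow_enorm_toReal (by norm_num) (by norm_num)]
  simp only [ENNReal.toReal_ofNat]
  gcongr
  exact (hG.sub hH).kfun_est hα

lemma wn_sub_le {α : ℝ} {G H K : ℂ → ℂ} (hG : ContinuousOn G {w : ℂ | 0 < w.re})
    (hK : ContinuousOn K {w : ℂ | 0 < w.re}) :
    wn α (fun w => G w - H w) ≤ 2 * wn α (fun w => G w - K w) + 2 * wn α (fun w => H w - K w) := by
  unfold wn
  rw [← lintegral_const_mul' _ _ (by simp), ← lintegral_const_mul' _ _ (by simp), ← lintegral_add_left']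
  · refine setLIntegral_mono' isOpen_hp.measurableSet fun w hw => ?_
    have hw : 0 < w.re := hw
    rw [show (2:ℝ≥0∞) = ENNReal.ofReal 2 by simp, ← ENNReal.ofReal_mul (by norm_num),
      ← ENNReal.ofReal_mul (by norm_num), ← ENNReal.ofReal_add (by positivity) (by positivity)]
    apply ENNReal.ofReal_le_ofReal
    rw [← mul_assoc, ← mul_assoc, ← add_mul]
    gcongr
    have : ‖G w - H w‖ ≤ ‖G w - K w‖ + ‖H w - K w‖ := by
      have h := norm_sub_le (G w - K w) (H w - K w)
      rwa [sub_sub_sub_cancel_right] at h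
    nlinarith [norm_nonneg (G w - H w), sq_nonneg (‖G w - K w‖ - ‖H w - K w‖)]
  · apply AEMeasurable.const_mul
    exact (wn_cont (hG.sub hK)).aemeasurable isOpen_hp.measurableSet

lemma wn_reg_tendsto {α : ℝ} {G : ℂ → ℂ} (hG : DifferentiableOn ℂ G {w : ℂ | 0 < w.re})
    (hfin : wn α G ≠ ∞) : Tendsto (fun n => wn α (fun w => reg G n w - G w)) atTop (𝓝 0) := by
  have h0 : (0:ℝ≥0∞) = ∫⁻ w in {w : ℂ | 0 < w.re}, 0 := by simp
  rw [h0]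
  unfold wn
  refine tendsto_lintegral_of_dominated_convergence'
    (fun w => 4 * ENNReal.ofReal (‖G w‖ ^ 2 * w.re ^ (α - 1))) ?_ ?_ ?_ ?_
  · intro n
    exact (wn_cont ((reg_diff hG n).continuousOn.sub hG.continuousOn)).aemeasurable isOpen_hp.measurableSet
  · intro n
    refine (ae_restrict_mem isOpen_hp.measurableSet).mono fun w hw => ?_
    have hw : 0 < w.re := hw
    beta_reduce
    rw [show (4:ℝ≥0∞) = ENNReal.ofReal 4 by simp, ← ENNReal.ofReal_mul (by norm_num)]
    apply ENNReal.ofReal_le_ofReal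
    rw [← mul_assoc]
    gcongr
    have := (norm_sub_le (reg G n w) (G w)).trans (add_le_add_left (reg_le G n hw) _)
    nlinarith [norm_nonneg (reg G n w - G w), norm_nonneg (G w)]
  · rw [lintegral_const_mul' _ _ (by simp)]
    exact ENNReal.mul_ne_top (by simp) hfin
  · refine Eventually.of_forall fun w => ?_
    have h1 : Tendsto (fun n => ‖reg G n w - G w‖ ^ 2 * w.re ^ (α - 1)) atTop (𝓝 (‖G w - G w‖ ^ 2 * w.re ^ (α - 1))) :=
      (((reg_tendsto G w).sub_const (G w)).norm.pow 2).mul_const _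
    have h2 := (ENNReal.continuous_ofReal.tendsto _).comp h1
    rw [sub_self, norm_zero, zero_pow two_ne_zero, zero_mul, ENNReal.ofReal_zero] at h2
    exact h2

lemma wn_reg_fin {α : ℝ} {G : ℂ → ℂ} (hfin : wn α G ≠ ∞) (n : ℕ) : wn α (reg G n) ≠ ∞ := by
  refine ne_top_of_le_ne_top hfin ?_
  refine setLIntegral_mono' isOpen_hp.measurableSet fun w hw => ?_
  have hw : 0 < w.re := hw
  apply ENNReal.ofReal_le_ofReal
  gcongr
  exact reg_le G n hw

lemma ker_mem {α : ℝ} (hα : 0 < α) {w : ℂ} (hw : 0 < w.re) :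
    MemLp (fun y : ℝ => starRingEnd ℂ (cexp (-(2 * Real.pi * y * w)) * ((y ^ (α / 2) : ℝ) : ℂ))) 2
      (volume.restrict (Ioi 0)) := by
  have hm : AEStronglyMeasurable (fun y : ℝ => starRingEnd ℂ (cexp (-(2 * Real.pi * y * w)) * ((y ^ (α / 2) : ℝ) : ℂ)))
      (volume.restrict (Ioi 0)) := by
    apply Measurable.aestronglyMeasurable
    refine Complex.continuous_conj.measurable.comp ?_
    fun_prop
  rw [memLp_two_iff_integrable_sq_norm hm]
  have h2 := integrableOn_rpow_mul_exp_neg_mul_rpow (p := 1) (s := α) (b := 4 * Real.pi * w.re)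
        (by linarith) (by norm_num) (by positivity)
  refine h2.congr_fun (fun y hy => ?_) measurableSet_Ioi
  have hy : 0 < y := hy
  simp only [RCLike.norm_conj]
  rw [norm_mul, Complex.norm_real, Real.norm_of_nonneg (by positivity), Complex.norm_exp, mul_pow,
    ← Real.exp_nat_mul, ← Real.rpow_natCast, ← Real.rpow_mul hy.le, mul_comm]
  congr 2
  · simp; ring
  · push_cast; ring

theorem paley_wiener {α : ℝ} (hα : 0 < α) {G : ℂ → ℂ} (hG : DifferentiableOn ℂ G {w : ℂ | 0 < w.re})
    (hfin : wn α G ≠ ∞) :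
    ∃ k : ℝ → ℂ, Measurable k ∧ IntegrableOn (fun y => ‖k y‖ ^ 2) (Ioi 0) ∧
      ∀ w : ℂ, 0 < w.re →
        G w = ∫ y in Ioi (0:ℝ), cexp (-(2 * Real.pi * y * w)) * ((y ^ (α / 2) : ℝ) : ℂ) * k y := by
  have hN := reg_nice hα hG hfin
  have hM := fun n => (hN n).kfun_mem hα (wn_reg_fin hfin n)
  set f : ℕ → Lp ℂ 2 (volume.restrict (Ioi (0:ℝ))) := fun n => (hM n).toLp with hf
  have hcau : CauchySeq f := by
    rw [EMetric.cauchySeq_iff]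
    intro ε hε
    set c := ENNReal.ofReal ((4 * Real.pi) ^ α / Real.Gamma α) with hc
    have hlim : Tendsto (fun p : ℕ × ℕ => (c * (2 * wn α (fun w => reg G p.1 w - G w) +
        2 * wn α (fun w => reg G p.2 w - G w))) ^ (1 / 2 : ℝ)) atTop (𝓝 0) := by
      have h1 := (wn_reg_tendsto hG hfin)
      have ha := ENNReal.Tendsto.const_mul (a := 2) (h1.comp (tendsto_fst.mono_left prod_atTop_atTop_eq.ge : Tendsto (Prod.fst : ℕ × ℕ → ℕ) atTop atTop)) (Or.inr (by simp))
      have hb := ENNReal.Tendsto.const_mul (a := 2) (h1.comp (tendsto_snd.mono_left prod_atTop_atTop_eq.ge : Tendsto (Prod.snd : ℕ × ℕ → ℕ) atTop atTop)) (Or.inr (by simp))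
      have h2 := ENNReal.Tendsto.const_mul (a := c) (ha.add hb) (Or.inr ENNReal.ofReal_ne_top)
      have h3 := h2.ennrpow_const (1 / 2 : ℝ)
      simpa using h3
    have hev := hlim.eventually (gt_mem_nhds hε)
    rw [eventually_atTop_prod_self'] at hev
    obtain ⟨N, hN'⟩ := hev
    refine ⟨N, fun m hm n hn => ?_⟩
    refine lt_of_le_of_lt ?_ (hN' m hm n hn)
    rw [hf, Lp.edist_toLp_toLp]
    refine ((hN m).kfun_dist hα (hN n)).trans ?_
    gcongr
    exact wn_sub_le (reg_diff hG m).continuousOn hG.continuousOn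
  obtain ⟨k, hk⟩ := cauchySeq_tendsto_of_complete hcau
  have hkm := (Lp.stronglyMeasurable k).measurable
  refine ⟨k, hkm, ?_, fun w hw => ?_⟩
  · exact (memLp_two_iff_integrable_sq_norm (Lp.aestronglyMeasurable k)).mp (Lp.memLp k)
  · set e := (ker_mem hα hw).toLp with he
    have h1 : Tendsto (fun n => inner ℂ e (f n)) atTop (𝓝 (inner ℂ e k)) :=
      Tendsto.inner tendsto_const_nhds hk
    have hcoe := (ker_mem hα hw).coeFn_toLp
    have h2 : ∀ n, inner ℂ e (f n) = reg G n w := by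
      intro n
      rw [L2.inner_def, ((hN n).inversion hw).2]
      apply integral_congr_ae
      filter_upwards [hcoe, (hM n).coeFn_toLp, ae_restrict_mem measurableSet_Ioi] with y h3 h4 hy
      have hy : 0 < y := hy
      rw [h3, h4, RCLike.inner_apply, kfun, RCLike.conj_conj]
      have h5 : ((y ^ (-(α / 2)) : ℝ) : ℂ) * ((y ^ (α / 2) : ℝ) : ℂ) = 1 := by
        rw [← ofReal_mul, ← Real.rpow_add hy]; simp
      linear_combination (lap (reg G n) 1 y * cexp (-(2 * Real.pi * y * w))) * h5
    have h3 : inner ℂ e k = ∫ y in Ioi (0:ℝ), cexp (-(2 * Real.pi * y * w)) * ((y ^ (α / 2) : ℝ) : ℂ) * k y := by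
      rw [L2.inner_def]
      apply integral_congr_ae
      filter_upwards [hcoe] with y h3
      rw [h3, RCLike.inner_apply, RCLike.conj_conj]
      ring
    simp_rw [h2] at h1
    rw [← h3]
    exact tendsto_nhds_unique (reg_tendsto G w) h1


lemma log_cpow_aux {z : ℂ} (hz : z ≠ 0) {a : ℝ} (h : |a * arg z| < Real.pi / 2) :
    log (z ^ (a : ℂ)) = a * log z ∧ 0 < (z ^ (a : ℂ)).re := by
  have him : (log z * (a : ℂ)).im = a * arg z := by
    simp [log_im, mul_comm]
  obtain ⟨h1, h2⟩ := abs_lt.mp h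
  have := Real.pi_pos
  constructor
  · rw [cpow_def_of_ne_zero hz, log_exp (by rw [him]; linarith) (by rw [him]; linarith), mul_comm]
  · rw [cpow_def_of_ne_zero hz, exp_re, him]
    exact mul_pos (Real.exp_pos _) (Real.cos_pos_of_mem_Ioo ⟨by linarith, h2⟩)

lemma arg_hp {w : ℂ} (hw : 0 < w.re) : |arg w| < Real.pi / 2 := by
  rw [abs_arg_lt_pi_div_two_iff]; exact Or.inl hw

lemma ne_hp {w : ℂ} (hw : 0 < w.re) : w ≠ 0 := by
  rintro rfl; simp at hw

lemma phi_facts {α : ℝ} (hα : 0 < α) (hα2 : α ≤ 2) {w : ℂ} (hw : 0 < w.re) :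
    w ^ ((α / 2 : ℝ) : ℂ) ∈ sector α ∧ (w ^ ((α / 2 : ℝ) : ℂ)) ^ ((2 / α : ℝ) : ℂ) = w := by
  have ha := arg_hp hw
  have h0 := ne_hp hw
  have h1 : |α / 2 * arg w| < Real.pi / 2 := by
    rw [abs_mul, abs_of_pos (by positivity)]
    nlinarith [abs_nonneg (arg w)]
  obtain ⟨h2, -⟩ := log_cpow_aux h0 h1
  have hne : w ^ ((α / 2 : ℝ) : ℂ) ≠ 0 := by simp [cpow_eq_zero_iff, h0]
  refine ⟨⟨hne, ?_⟩, ?_⟩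
  · rw [← log_im, h2, im_ofReal_mul, log_im, abs_mul, abs_of_pos (by positivity)]
    nlinarith
  · rw [cpow_def_of_ne_zero hne, h2]
    rw [show ((α / 2 : ℝ) : ℂ) * log w * ((2 / α : ℝ) : ℂ) = log w by
      have : (α : ℂ) ≠ 0 := by exact_mod_cast hα.ne'
      push_cast; field_simp]
    exact exp_log h0

lemma psi_facts {α : ℝ} (hα : 0 < α) {z : ℂ} (hz : z ∈ sector α) :
    0 < (z ^ ((2 / α : ℝ) : ℂ)).re ∧ (z ^ ((2 / α : ℝ) : ℂ)) ^ ((α / 2 : ℝ) : ℂ) = z := by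
  obtain ⟨h0, h1⟩ := hz
  have h3 : |2 / α * arg z| < Real.pi / 2 := by
    rw [abs_mul, abs_of_pos (by positivity)]
    calc 2 / α * |arg z| < 2 / α * (Real.pi * α / 4) := by gcongr
      _ = Real.pi / 2 := by field_simp; norm_num
  obtain ⟨h4, h5⟩ := log_cpow_aux h0 h3
  refine ⟨h5, ?_⟩
  rw [cpow_def_of_ne_zero (ne_hp h5), h4]
  rw [show ((2 / α : ℝ) : ℂ) * log z * ((α / 2 : ℝ) : ℂ) = log z by
      have : (α : ℂ) ≠ 0 := by exact_mod_cast hα.ne'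
      push_cast; field_simp]
  exact exp_log h0

lemma phi_image {α : ℝ} (hα : 0 < α) (hα2 : α ≤ 2) :
    (fun w : ℂ => w ^ ((α / 2 : ℝ) : ℂ)) '' {w : ℂ | 0 < w.re} = sector α := by
  ext z
  constructor
  · rintro ⟨w, hw, rfl⟩
    exact (phi_facts hα hα2 hw).1
  · intro hz
    exact ⟨_, (psi_facts hα hz).1, (psi_facts hα hz).2⟩

lemma phi_deriv (a : ℝ) {w : ℂ} (hw : 0 < w.re) :
    HasDerivAt (fun w : ℂ => w ^ (a : ℂ)) (a * w ^ ((a : ℂ) - 1)) w := by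
  simpa using (hasDerivAt_id w).cpow_const (c := (a : ℂ)) (Or.inl hw)

lemma det_smul_one (c : ℂ) : (c • (1 : ℂ →L[ℝ] ℂ)).det = ‖c‖ ^ 2 := by
  have : ((c • (1 : ℂ →L[ℝ] ℂ) : ℂ →L[ℝ] ℂ) : ℂ →ₗ[ℝ] ℂ) = Algebra.lmul ℝ ℂ c := by
    ext <;> simp
  rw [ContinuousLinearMap.det, this, ← Algebra.norm_apply, Algebra.norm_complex_apply, Complex.sq_norm]

/-- Transferred function on the half-plane. -/
noncomputable def Gtr (α t : ℝ) (F : ℂ → ℂ) (w : ℂ) : ℂ :=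
  F (w ^ ((α / 2 : ℝ) : ℂ)) / w ^ ((α / 2 : ℝ) : ℂ) * cexp ((α ^ 2 / (4 * t) : ℝ) * w)

lemma Gtr_diff {α t : ℝ} (hα : 0 < α) (hα2 : α ≤ 2) {F : ℂ → ℂ} (hF : DifferentiableOn ℂ F (sector α)) :
    DifferentiableOn ℂ (Gtr α t F) {w : ℂ | 0 < w.re} := by
  have hφ : DifferentiableOn ℂ (fun w : ℂ => w ^ ((α / 2 : ℝ) : ℂ)) {w : ℂ | 0 < w.re} :=
    fun w hw => (phi_deriv (α / 2) hw).differentiableAt.differentiableWithinAt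
  apply DifferentiableOn.mul _ (by fun_prop)
  apply DifferentiableOn.div _ hφ
  · intro w hw; exact (phi_facts hα hα2 hw).1.1
  · exact hF.comp hφ fun w hw => (phi_facts hα hα2 hw).1

lemma muConst_pos {α : ℝ} (hα : 0 < α) : 0 < (Real.pi)⁻¹ * 2 ^ (α - 1) * betaFn (α / 2) (α / 2) := by
  have h1 := Real.Gamma_pos_of_pos (half_pos hα)
  have h2 := Real.Gamma_pos_of_pos (show 0 < α / 2 + α / 2 by positivity)
  unfold betaFn
  positivity

lemma wn_Gtr {α t : ℝ} (hα : 0 < α) (hα2 : α ≤ 2) (ht : 0 < t) {F : ℂ → ℂ}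
    (hFint : IntegrableOn (fun z => ‖F z‖ ^ 2 * muDens α t z) (sector α)) :
    wn α (Gtr α t F) ≠ ∞ := by
  rw [← phi_image hα hα2, integrableOn_image_iff_integrableOn_abs_det_fderiv_smul volume isOpen_hp.measurableSet
    (fun w hw => (phi_deriv (α / 2) hw).complexToReal_fderiv.hasFDerivWithinAt) ] at hFint
  swap
  · intro w hw w' hw' h
    rw [← (phi_facts hα hα2 hw).2, ← (phi_facts hα hα2 hw').2]
    exact congrArg (fun z : ℂ => z ^ ((2 / α : ℝ) : ℂ)) h
  set c := (Real.pi)⁻¹ * 2 ^ (α - 1) * betaFn (α / 2) (α / 2) with hc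
  have hc0 : 0 < c := muConst_pos hα
  have h2 := hFint.const_mul (((α / 2) ^ 2 * c)⁻¹)
  have h3 : IntegrableOn (fun w : ℂ => ‖Gtr α t F w‖ ^ 2 * w.re ^ (α - 1)) {w : ℂ | 0 < w.re} := by
    refine IntegrableOn.congr_fun h2 (fun w hw => ?_) isOpen_hp.measurableSet
    have hw : 0 < w.re := hw
    have hn : 0 < ‖w‖ := norm_pos_iff.mpr (ne_hp hw)
    beta_reduce
    rw [det_smul_one, smul_eq_mul, muDens, ← hc, (phi_facts hα hα2 hw).2, Gtr]
    rw [norm_mul, norm_mul, norm_div, Complex.norm_exp, Complex.norm_cpow_real, Complex.norm_real,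
      abs_of_nonneg (by positivity), show (((α / 2 : ℝ) : ℂ) - 1) = ((α / 2 - 1 : ℝ) : ℂ) by push_cast; rfl,
      Complex.norm_cpow_real, Real.norm_of_nonneg (by positivity : 0 ≤ α / 2), re_ofReal_mul,
      mul_pow, mul_pow, div_pow ‖F _‖, ← Real.exp_nat_mul, ← Real.rpow_mul hn.le,
      ← Real.rpow_natCast (‖w‖ ^ (α / 2 - 1)), ← Real.rpow_natCast (‖w‖ ^ (α / 2)),
      ← Real.rpow_mul hn.le, ← Real.rpow_mul hn.le]
    have e1 : ‖w‖ ^ ((α / 2 - 1) * ((2:ℕ):ℝ)) * ‖w‖ ^ (α / 2 * (4 * (1 - α) / α)) = (‖w‖ ^ (α / 2 * ((2:ℕ):ℝ)))⁻¹ := by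
      rw [← Real.rpow_add hn, ← Real.rpow_neg hn.le]
      congr 1
      push_cast
      field_simp
      ring
    have e2 : ((2:ℕ):ℝ) * (α ^ 2 / (4 * t) * w.re) = α ^ 2 / (2 * t) * w.re := by
      push_cast; field_simp; norm_num
    rw [e2, div_eq_mul_inv (‖F _‖ ^ 2), ← e1]
    field_simp
  exact h3.lintegral_lt_top.ne


lemma sub_image {A t : ℝ} (hA : 0 < A) (ht : 0 < t) :
    (fun τ : ℝ => A * τ / (t - τ)) '' Ioo 0 t = Ioi 0 := by
  ext y
  constructor
  · rintro ⟨τ, ⟨h1, h2⟩, rfl⟩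
    have : 0 < t - τ := sub_pos.mpr h2
    exact div_pos (mul_pos hA h1) this
  · intro hy
    have hy : 0 < y := hy
    have h0 : 0 < A + y := by positivity
    have h1 : t - t * y / (A + y) = t * A / (A + y) := by field_simp; ring
    refine ⟨t * y / (A + y), ⟨by positivity, ?_⟩, ?_⟩
    · have : 0 < t * A / (A + y) := by positivity
      linarith
    · beta_reduce
      rw [h1]; field_simp

lemma sub_deriv {A t τ : ℝ} (h : τ < t) :
    HasDerivAt (fun τ : ℝ => A * τ / (t - τ)) (A * t / (t - τ) ^ 2) τ := by
  have h1 : t - τ ≠ 0 := (sub_pos.mpr h).ne'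
  have := (((hasDerivAt_id τ).const_mul A).div ((hasDerivAt_id τ).const_sub t) h1)
  have e : A * t / (t - τ) ^ 2 = (A * 1 * (t - τ) - A * τ * (-1)) / (t - τ) ^ 2 := by
    congr 1; ring
  rw [e]
  exact this

lemma sub_inj {A t : ℝ} (hA : 0 < A) (ht : 0 < t) :
    InjOn (fun τ : ℝ => A * τ / (t - τ)) (Ioo 0 t) := by
  rintro a ⟨_, ha⟩ b ⟨_, hb⟩ h
  have h1 : t - a ≠ 0 := (sub_pos.mpr ha).ne'
  have h2 : t - b ≠ 0 := (sub_pos.mpr hb).ne'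
  beta_reduce at h
  rw [div_eq_div_iff h1 h2] at h
  have : A * t * (a - b) = 0 := by linarith
  have h3 : A * t ≠ 0 := by positivity
  have := (mul_eq_zero.mp this).resolve_left h3
  linarith

lemma transfer {α t : ℝ} (hα : 0 < α) (ht : 0 < t) {k : ℝ → ℂ} (hk : Measurable k)
    (hki : IntegrableOn (fun y => ‖k y‖ ^ 2) (Ioi 0)) :
    ∃ g : ℝ → ℂ, Measurable g ∧
      IntegrableOn (fun τ => ‖g τ‖ ^ 2 * τ ^ α) (Set.Ioo 0 t) ∧
      ∀ z : ℂ, Lc α t g z = z * (∫ y in Ioi (0:ℝ), cexp (-(2 * Real.pi * y * z ^ ((2 / α : ℝ) : ℂ))) *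
        ((y ^ (α / 2) : ℝ) : ℂ) * k y) * cexp (-((α ^ 2 / (4 * t) : ℝ) * z ^ ((2 / α : ℝ) : ℂ))) := by
  set A := α ^ 2 / (8 * Real.pi * t) with hAd
  have hpi := Real.pi_pos
  have hA : 0 < A := by positivity
  set c := α ^ α / (2 ^ α * Real.Gamma (α / 2)) with hcd
  have hc : 0 < c := by
    have := Real.Gamma_pos_of_pos (half_pos hα)
    positivity
  obtain ⟨D, hD⟩ : ∃ D : ℝ, D = t ^ α / c * (A * t) * A ^ (α / 2) := ⟨_, rfl⟩
  have hD0 : 0 < D := by rw [hD]; positivity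
  refine ⟨fun τ => ((D * (t - τ)⁻¹ * τ ^ (-(α / 2)) : ℝ) : ℂ) * k (A * τ / (t - τ)), ?_, ?_, ?_⟩
  · have : Measurable fun τ => k (A * τ / (t - τ)) := hk.comp (by fun_prop)
    fun_prop
  · rw [← sub_image hA ht, integrableOn_image_iff_integrableOn_abs_deriv_smul measurableSet_Ioo
      (fun x hx => (sub_deriv hx.2).hasDerivWithinAt) (sub_inj hA ht)] at hki
    refine IntegrableOn.congr_fun (hki.const_mul (D ^ 2 / (A * t))) (fun τ hτ => ?_) measurableSet_Ioo
    have h1 : 0 < t - τ := sub_pos.mpr hτ.2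
    have h0 : 0 < τ := hτ.1
    beta_reduce
    rw [abs_of_pos (by positivity), smul_eq_mul, norm_mul, Complex.norm_real, mul_pow, Real.norm_eq_abs, sq_abs,
      mul_pow, mul_pow, ← Real.rpow_natCast (τ ^ (-(α / 2))), ← Real.rpow_mul h0.le]
    have e : τ ^ (-(α / 2) * ((2:ℕ):ℝ)) = (τ ^ α)⁻¹ := by
      rw [← Real.rpow_neg h0.le]; congr 1; push_cast; ring
    have : 0 < τ ^ α := by positivity
    rw [e]; field_simp
  · intro z
    rw [← sub_image hA ht, integral_image_eq_integral_abs_deriv_smul measurableSet_Ioo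
      (fun x hx => (sub_deriv hx.2).hasDerivWithinAt) (sub_inj hA ht), Lc, mul_right_comm, ← integral_const_mul,
      ← integral_const_mul]
    refine setIntegral_congr_fun measurableSet_Ioo fun τ hτ => ?_
    have h1 : 0 < t - τ := sub_pos.mpr hτ.2
    have h0 : 0 < τ := hτ.1
    set w := z ^ ((2 / α : ℝ) : ℂ) with hw
    beta_reduce
    rw [abs_of_pos (by positivity), Complex.real_smul, Kc, ← hw, ← hcd]
    have e1 : cexp (-(α ^ 2 : ℂ) * w / (4 * ((t - τ : ℝ) : ℂ))) =
        cexp (-((α ^ 2 / (4 * t) : ℝ) * w)) * cexp (-(2 * Real.pi * ((A * τ / (t - τ) : ℝ) : ℂ) * w)) := by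
      rw [← Complex.exp_add]
      congr 1
      have : α ^ 2 / (4 * (t - τ)) = α ^ 2 / (4 * t) + 2 * Real.pi * (A * τ / (t - τ)) := by
        rw [hAd]; field_simp; ring
      have := congrArg (fun x : ℝ => (x : ℂ)) this
      push_cast at this ⊢
      linear_combination (-w) * this
    have e2 : t ^ (-α) * (c * (t - τ) ^ (-(α / 2 + 1)) * (D * (t - τ)⁻¹ * τ ^ (-(α / 2))) * τ ^ α) =
        A * t / (t - τ) ^ 2 * (A * τ / (t - τ)) ^ (α / 2) := by
      rw [Real.div_rpow (by positivity) h1.le, Real.mul_rpow hA.le h0.le, Real.rpow_neg ht.le,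
        Real.rpow_neg h1.le, Real.rpow_add h1, Real.rpow_one, Real.rpow_neg h0.le,
        show τ ^ α = τ ^ (α / 2) * τ ^ (α / 2) by rw [← Real.rpow_add h0]; congr 1; ring, hD]
      have : 0 < t ^ α := by positivity
      have : 0 < τ ^ (α / 2) := by positivity
      have : 0 < (t - τ) ^ (α / 2) := by positivity
      field_simp
    have e2 := congrArg (fun x : ℝ => (x : ℂ)) e2
    rw [e1]
    simp only [ofReal_mul] at e2 ⊢
    linear_combination (z * cexp (-(((α ^ 2 / (4 * t) : ℝ) : ℂ) * w)) * cexp (-(2 * Real.pi * ((A * τ / (t - τ) : ℝ) : ℂ) * w)) * k (A * τ / (t - τ))) * e2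


end Helpers

theorem stmt15 (α t : ℝ) (hα : 0 < α) (hα2 : α ≤ 2) (ht : 0 < t)
    (F : ℂ → ℂ) (hF : DifferentiableOn ℂ F (sector α))
    (hFint : IntegrableOn (fun z => ‖F z‖ ^ 2 * muDens α t z) (sector α)) :
    ∃ g : ℝ → ℂ, Measurable g ∧
      IntegrableOn (fun τ => ‖g τ‖ ^ 2 * τ ^ α) (Set.Ioo 0 t) ∧
      ∀ z ∈ sector α, F z = Lc α t g z := by
  obtain ⟨k, hk, hki, hrep⟩ := paley_wiener hα (Gtr_diff (t := t) hα hα2 hF) (wn_Gtr hα hα2 ht hFint)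
  obtain ⟨g, hg, hgi, hL⟩ := transfer hα ht hk hki
  refine ⟨g, hg, hgi, fun z hz => ?_⟩
  obtain ⟨h1, h2⟩ := psi_facts hα hz
  have h0 : z ≠ 0 := hz.1
  rw [hL, ← hrep _ h1, Gtr, h2, Complex.exp_neg]
  have := Complex.exp_ne_zero (((α ^ 2 / (4 * t) : ℝ) : ℂ) * z ^ ((2 / α : ℝ) : ℂ))
  field_simp
end
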